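/- The sorting number of the complete p-partite graph K_{n/p,...,n/p} on n vertices (p ≥ 2 parts of equal size n/p) is Θ(log n). -/

import Mathlib

open Finset

variable {V : Type*}

/-- A stage of a sorting network on a graph `G`: a finite set of vertex-disjoint
edges of `G`, each either directed (compare-exchange) or undirected (swap). -/
structure Stage {V : Type*} (G : SimpleGraph V) where
  pairs : Finset (V × V)
  adj : ∀ p ∈ pairs, G.Adj p.1 p.2
  directed : V × V → Bool
  disj : ∀ p ∈ pairs, ∀ q ∈ pairs, p ≠ q →
    p.1 ≠ q.1 ∧ p.1 ≠ q.2 ∧ p.2 ≠ q.1 ∧ p.2 ≠ q.2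

open scoped Classical in
/-- Apply a stage to a configuration of keys `f : V → ℕ`.  For a directed pair
`(u,v)` the smaller key goes to `u` and the larger to `v`; an undirected pair
unconditionally swaps its keys. -/
noncomputable def Stage.apply {G : SimpleGraph V} (s : Stage G) (f : V → ℕ) (v : V) : ℕ :=
  if h1 : ∃ p, p ∈ s.pairs ∧ p.1 = v then
    (if s.directed h1.choose then min (f h1.choose.1) (f h1.choose.2) else f h1.choose.2)
  else if h2 : ∃ p, p ∈ s.pairs ∧ p.2 = v then
    (if s.directed h2.choose then max (f h2.choose.1) (f h2.choose.2) else f h2.choose.1)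
  else f v

noncomputable def runNetwork {G : SimpleGraph V} (L : List (Stage G)) (f : V → ℕ) : V → ℕ :=
  L.foldl (fun g s => s.apply g) f

/-- `L` is a sorting network on `(G, π)`: for every injective assignment of keys,
after running all stages, the key at a vertex of smaller `π`-rank is smaller. -/
def IsSortingNetwork {n : ℕ} (G : SimpleGraph V) (π : V ≃ Fin n) (L : List (Stage G)) : Prop :=
  ∀ f : V → ℕ, Function.Injective f →
    ∀ u w : V, π u < π w → runNetwork L f u < runNetwork L f w

/-- Minimal depth of a sorting network on `(G, π)`. -/
noncomputable def stP {n : ℕ} (G : SimpleGraph V) (π : V ≃ Fin n) : ℕ :=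
  sInf {t | ∃ L : List (Stage G), L.length = t ∧ IsSortingNetwork G π L}

/-- The sorting number of `G` : the minimum over sorted orders `π` of the
minimal depth of a sorting network on `(G, π)`. -/
noncomputable def st [Fintype V] (G : SimpleGraph V) : ℕ :=
  sInf {t | ∃ π : V ≃ Fin (Fintype.card V), ∃ L : List (Stage G),
    L.length = t ∧ IsSortingNetwork G π L}

/-- A matching step: an involution of the vertices moving pebbles only along edges. -/
def IsMatchingStep (G : SimpleGraph V) (σ : Equiv.Perm V) : Prop :=
  (∀ v, σ (σ v) = v) ∧ ∀ v, σ v ≠ v → G.Adj v (σ v)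

/-- Position of a pebble starting at `v` after applying the matching steps in `L`. -/
def finalPos (L : List (Equiv.Perm V)) (v : V) : V :=
  L.foldl (fun p σ => σ p) v

/-- `t` matching steps of `G` suffice to route every pebble from `v` to `σ v`. -/
def RoutesIn (G : SimpleGraph V) (σ : Equiv.Perm V) (t : ℕ) : Prop :=
  ∃ L : List (Equiv.Perm V), L.length = t ∧ (∀ τ ∈ L, IsMatchingStep G τ) ∧
    ∀ v, finalPos L v = σ v

/-- Routing time of the permutation `σ` on `G`. -/
noncomputable def rtP (G : SimpleGraph V) (σ : Equiv.Perm V) : ℕ :=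
  sInf {t | RoutesIn G σ t}

/-- The routing number of `G`. -/
noncomputable def rt [Fintype V] [DecidableEq V] (G : SimpleGraph V) : ℕ :=
  Finset.univ.sup fun σ : Equiv.Perm V => rtP G σ

/-- The complete `p`-partite graph with parts of size `m`:
two vertices are adjacent iff they lie in different parts. -/
def multipartite (p m : ℕ) : SimpleGraph (Fin p × Fin m) :=
  (⊤ : SimpleGraph (Fin p)).comap Prod.fst

namespace AKS

/-- A stage of compare-exchanges on the complete graph. -/
structure CS (W : Type*) where
  σ : W → W
  mn : W → Bool
  inv : ∀ w, σ (σ w) = w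
  anti : ∀ w, σ w ≠ w → mn (σ w) = !mn w

def CS.app {W α : Type*} [LinearOrder α] (s : CS W) (f : W → α) (w : W) : α :=
  if s.mn w then min (f w) (f (s.σ w)) else max (f w) (f (s.σ w))

def run {W α : Type*} [LinearOrder α] (L : List (CS W)) (f : W → α) : W → α :=
  L.foldl (fun g s => s.app g) f

section basic
variable {W α β : Type*} [LinearOrder α] [LinearOrder β]

@[simp] lemma run_nil (f : W → α) : run [] f = f := rfl
@[simp] lemma run_cons (s : CS W) (L : List (CS W)) (f : W → α) :
    run (s :: L) f = run L (s.app f) := rfl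
lemma run_append (L M : List (CS W)) (f : W → α) : run (L ++ M) f = run M (run L f) := by
  simp [run, List.foldl_append]

lemma app_comp (s : CS W) (f : W → α) {φ : α → β} (h : Monotone φ) :
    s.app (fun w => φ (f w)) = fun w => φ (s.app f w) := by
  funext w
  unfold CS.app
  split_ifs
  · exact (h.map_min).symm
  · exact (h.map_max).symm

lemma run_comp (L : List (CS W)) (f : W → α) {φ : α → β} (h : Monotone φ) :
    run L (fun w => φ (f w)) = fun w => φ (run L f w) := by
  induction L generalizing f with
  | nil => rfl
  | cons s L ih => rw [run_cons, run_cons, app_comp s f h, ih]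

lemma app_mono (s : CS W) {f g : W → α} (h : ∀ w, f w ≤ g w) (w : W) : s.app f w ≤ s.app g w := by
  unfold CS.app
  split_ifs
  · exact min_le_min (h _) (h _)
  · exact max_le_max (h _) (h _)

lemma run_mono (L : List (CS W)) {f g : W → α} (h : ∀ w, f w ≤ g w) (w : W) :
    run L f w ≤ run L g w := by
  induction L generalizing f g with
  | nil => exact h w
  | cons s L ih => exact ih (app_mono s h)

lemma app_perm (s : CS W) (f : W → α) : ∃ e : Equiv.Perm W, s.app f = fun w => f (e w) := by
  classical
  let st : W → Prop := fun w => if s.mn w then f w ≤ f (s.σ w) else f (s.σ w) ≤ f w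
  have hst : ∀ w, s.σ w ≠ w → (st (s.σ w) ↔ st w) := by
    intro w hw
    have := s.anti w hw
    simp only [st, this, s.inv]
    cases s.mn w <;> simp
  let e : W → W := fun w => if st w then w else s.σ w
  have he : Function.Involutive e := by
    intro w
    by_cases h : st w
    · simp [e, h]
    · by_cases hw : s.σ w = w
      · simp [e, h, hw]
      · have := (hst w hw).not.mpr h
        simp [e, h, this, s.inv]
  refine ⟨he.toPerm, ?_⟩
  funext w
  change s.app f w = f (e w)
  simp only [e, st, CS.app]
  cases s.mn w
  · by_cases h : f (s.σ w) ≤ f w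
    · simp [h]
    · simp [h, (not_le.mp h).le]
  · by_cases h : f w ≤ f (s.σ w)
    · simp [h]
    · simp [h, (not_le.mp h).le]

lemma run_perm (L : List (CS W)) (f : W → α) :
    ∃ e : Equiv.Perm W, run L f = fun w => f (e w) := by
  induction L generalizing f with
  | nil => exact ⟨Equiv.refl _, rfl⟩
  | cons s L ih =>
    obtain ⟨e, he⟩ := app_perm s f
    obtain ⟨e', he'⟩ := ih (s.app f)
    refine ⟨e'.trans e, ?_⟩
    rw [run_cons, he', he]
    rfl

lemma run_count [Fintype W] (L : List (CS W)) (f : W → α) (P : α → Prop) [DecidablePred P] :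
    (univ.filter fun w => P (run L f w)).card = (univ.filter fun w => P (f w)).card := by
  obtain ⟨e, he⟩ := run_perm L f
  rw [he]
  exact Finset.card_bij (fun w _ => e w) (by simp) (by simp) (fun b hb => ⟨e.symm b, by simpa using hb⟩)

/-- the idle stage -/
def idle (W : Type*) : CS W := ⟨id, fun _ => true, fun _ => rfl, fun _ h => absurd rfl h⟩

lemma idle_app (f : W → α) : (idle W).app f = f := by
  funext w; simp [CS.app, idle]

lemma run_idle (k : ℕ) (f : W → α) : run (List.replicate k (idle W)) f = f := by
  induction k with
  | zero => rfl
  | succ k ih => rw [List.replicate_succ, run_cons, idle_app, ih]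

/-- transport along an embedding -/
noncomputable def embed {U : Type*} (ι : U ↪ W) (s : CS U) : CS W := by
  classical
  exact
  { σ := fun w => if h : ∃ u, ι u = w then ι (s.σ h.choose) else w
    mn := fun w => if h : ∃ u, ι u = w then s.mn h.choose else true
    inv := by
      intro w
      by_cases h : ∃ u, ι u = w
      · have h2 : ∃ u, ι u = ι (s.σ h.choose) := ⟨_, rfl⟩
        have h3 : h2.choose = s.σ h.choose := ι.injective h2.choose_spec
        rw [dif_pos h, dif_pos h2, h3, s.inv]
        exact h.choose_spec
      · simp [h]
    anti := by
      intro w hw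
      by_cases h : ∃ u, ι u = w
      · have h2 : ∃ u, ι u = ι (s.σ h.choose) := ⟨_, rfl⟩
        have h3 : h2.choose = s.σ h.choose := ι.injective h2.choose_spec
        rw [dif_pos h] at hw
        simp only [dif_pos h, dif_pos h2, h3]
        apply s.anti
        intro h4
        rw [h4] at hw
        exact hw h.choose_spec
      · simp [h] at hw }

lemma embed_σ {U : Type*} (ι : U ↪ W) (s : CS U) (u : U) : (embed ι s).σ (ι u) = ι (s.σ u) := by
  classical
  have h : ∃ u', ι u' = ι u := ⟨u, rfl⟩
  have h3 : h.choose = u := ι.injective h.choose_spec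
  simp only [embed]
  rw [dif_pos h, h3]

lemma embed_mn {U : Type*} (ι : U ↪ W) (s : CS U) (u : U) : (embed ι s).mn (ι u) = s.mn u := by
  classical
  have h : ∃ u', ι u' = ι u := ⟨u, rfl⟩
  have h3 : h.choose = u := ι.injective h.choose_spec
  simp only [embed]
  rw [dif_pos h, h3]

lemma embed_σ_off {U : Type*} (ι : U ↪ W) (s : CS U) (w : W) (h : ∀ u, ι u ≠ w) :
    (embed ι s).σ w = w := by
  simp [embed, h]

lemma embed_app {U : Type*} (ι : U ↪ W) (s : CS U) (f : W → α) :
    (fun u => (embed ι s).app f (ι u)) = s.app (fun u => f (ι u)) := by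
  funext u
  simp [CS.app, embed_σ, embed_mn]

lemma embed_app_off {U : Type*} (ι : U ↪ W) (s : CS U) (f : W → α) (w : W) (h : ∀ u, ι u ≠ w) :
    (embed ι s).app f w = f w := by
  simp [CS.app, embed_σ_off ι s w h]

lemma embed_run {U : Type*} (ι : U ↪ W) (L : List (CS U)) (f : W → α) :
    (fun u => run (L.map (embed ι)) f (ι u)) = run L (fun u => f (ι u)) := by
  induction L generalizing f with
  | nil => rfl
  | cons s L ih => rw [List.map_cons, run_cons, run_cons, ← embed_app, ← ih]

lemma embed_run_off {U : Type*} (ι : U ↪ W) (L : List (CS U)) (f : W → α) (w : W)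
    (h : ∀ u, ι u ≠ w) : run (L.map (embed ι)) f w = f w := by
  induction L generalizing f with
  | nil => rfl
  | cons s L ih => rw [List.map_cons, run_cons, ih, embed_app_off ι s f w h]

/-- parallel composition on a sigma type -/
def sig {C : Type*} {U : C → Type*} (S : ∀ c, CS (U c)) : CS (Σ c, U c) where
  σ := fun z => ⟨z.1, (S z.1).σ z.2⟩
  mn := fun z => (S z.1).mn z.2
  inv := by rintro ⟨c, p⟩; simp [(S c).inv]
  anti := by
    rintro ⟨c, p⟩ h
    apply (S c).anti
    intro h2
    apply h
    simp [h2]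

lemma sig_run {C : Type*} {U : C → Type*} (q : ℕ) (L : ∀ c, List (CS (U c)))
    (hL : ∀ c, (L c).length = q) : ∃ M : List (CS (Σ c, U c)), M.length = q ∧
      ∀ {α : Type} [LinearOrder α] (f : (Σ c, U c) → α) c,
        (fun p => run M f ⟨c, p⟩) = run (L c) (fun p => f ⟨c, p⟩) := by
  induction q generalizing L with
  | zero =>
    refine ⟨[], rfl, fun {α} _ f c => ?_⟩
    rw [List.length_eq_zero_iff.mp (hL c)]; rfl
  | succ q ih =>
    have : ∀ c, ∃ s M, L c = s :: M := fun c => List.exists_cons_of_length_eq_add_one (hL c)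
    choose s M hM using this
    obtain ⟨N, hN, hN'⟩ := ih M (fun c => by have := hL c; rw [hM] at this; simpa using this)
    refine ⟨sig s :: N, by simp [hN], fun {α} _ f c => ?_⟩
    rw [hM, run_cons, run_cons, hN']
    rfl

end basic

/-! ### Existence of expanding families of permutations -/

lemma perm_count_step {m : ℕ} (Y : Finset (Fin m)) (X : Finset (Fin m)) (a : Fin m) (ha : a ∉ X) :
    (univ.filter fun π : Equiv.Perm (Fin m) => ∀ x ∈ insert a X, π x ∈ Y).card * (m - X.card)
     = (univ.filter fun π : Equiv.Perm (Fin m) => ∀ x ∈ X, π x ∈ Y).card * (Y.card - X.card) := by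
  classical
  set N' := univ.filter fun π : Equiv.Perm (Fin m) => ∀ x ∈ insert a X, π x ∈ Y
  set N := univ.filter fun π : Equiv.Perm (Fin m) => ∀ x ∈ X, π x ∈ Y
  have h1 : N'.card * (m - X.card) = (N' ×ˢ Xᶜ).card := by
    rw [card_product, card_compl, Fintype.card_fin]
  have h2 : N.card * (Y.card - X.card) = ((N ×ˢ Xᶜ).filter fun z => z.1 z.2 ∈ Y).card := by
    rw [Finset.card_filter _ (N ×ˢ Xᶜ), Finset.sum_product, ← smul_eq_mul, ← Finset.sum_const]
    apply Finset.sum_congr rfl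
    intro π hπ
    rw [← Finset.card_filter]
    have hsub : X.map π.toEmbedding ⊆ Y := by
      intro y hy
      simp only [mem_map, Equiv.coe_toEmbedding] at hy
      obtain ⟨x, hx, rfl⟩ := hy
      exact (mem_filter.mp hπ).2 x hx
    have := card_sdiff_of_subset hsub
    rw [card_map] at this
    rw [← this]
    symm
    apply Finset.card_bij (fun c _ => π c)
    · intro c hc
      simp only [mem_filter, mem_compl] at hc
      simp [hc.1, hc.2]
    · intro c _ c' _ h; exact π.injective h
    · intro b hb
      simp only [mem_sdiff, mem_map, Equiv.coe_toEmbedding, not_exists, not_and] at hb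
      refine ⟨π.symm b, ?_, by simp⟩
      simp only [mem_filter, mem_compl, Equiv.apply_symm_apply]
      exact ⟨fun h => hb.2 _ h (by simp), hb.1⟩
  rw [h1, h2]
  apply Finset.card_bij (fun z _ => ((Equiv.swap a z.2).trans z.1, z.2))
  · rintro ⟨π, c⟩ h
    simp only [N', N, mem_filter, mem_product, mem_compl, mem_univ, true_and, mem_insert,
      forall_eq_or_imp, Equiv.trans_apply] at h ⊢
    refine ⟨⟨?_, h.2⟩, by simpa using h.1.1⟩
    intro x hx
    rw [Equiv.swap_apply_of_ne_of_ne (by rintro rfl; exact ha hx) (by rintro rfl; exact h.2 hx)]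
    exact h.1.2 x hx
  · rintro ⟨π, c⟩ _ ⟨π', c'⟩ _ h
    simp only [Prod.mk.injEq] at h
    obtain ⟨h, rfl⟩ := h
    have : π = π' := by
      ext x
      have := DFunLike.congr_fun h (Equiv.swap a c x)
      simpa using congrArg Fin.val this
    rw [this]
  · rintro ⟨π, c⟩ h
    simp only [N, mem_filter, mem_product, mem_compl, mem_univ, true_and] at h
    refine ⟨((Equiv.swap a c).trans π, c), ?_, ?_⟩
    · simp only [N', mem_filter, mem_product, mem_compl, mem_univ, true_and, mem_insert,
        forall_eq_or_imp, Equiv.trans_apply]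
      refine ⟨⟨by simpa using h.2, ?_⟩, h.1.2⟩
      intro x hx
      rw [Equiv.swap_apply_of_ne_of_ne (by rintro rfl; exact ha hx) (by rintro rfl; exact h.1.2 hx)]
      exact h.1.1 x hx
    · simp only [Prod.mk.injEq, and_true]
      ext x; simp

lemma perm_count {m : ℕ} (Y X : Finset (Fin m)) :
    (univ.filter fun π : Equiv.Perm (Fin m) => ∀ x ∈ X, π x ∈ Y).card * m ^ X.card
      ≤ m.factorial * Y.card ^ X.card := by
  classical
  induction X using Finset.induction_on with
  | empty => simp [Fintype.card_perm]
  | insert a X ha ih =>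
    have h := perm_count_step Y X a ha
    set N' := (univ.filter fun π : Equiv.Perm (Fin m) => ∀ x ∈ insert a X, π x ∈ Y).card
    set N := (univ.filter fun π : Equiv.Perm (Fin m) => ∀ x ∈ X, π x ∈ Y).card
    rw [card_insert_of_notMem ha]
    have hm : X.card < m := by
      have := card_lt_univ_of_notMem ha
      simpa using this
    have hY : Y.card ≤ m := by simpa using card_le_univ Y
    have key : N' * m ≤ N * Y.card := by
      have h3 : (Y.card - X.card) * m ≤ Y.card * (m - X.card) := by
        rcases le_total Y.card X.card with h | h
        · simp [Nat.sub_eq_zero_of_le h]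
        · zify [h, hm.le]
          have : (X.card : ℤ) * Y.card ≤ X.card * m := by gcongr
          linarith
      have h4 : N' * m * (m - X.card) ≤ N * Y.card * (m - X.card) := by
        calc N' * m * (m - X.card) = (N' * (m - X.card)) * m := by ring
          _ = N * ((Y.card - X.card) * m) := by rw [h]; ring
          _ ≤ N * (Y.card * (m - X.card)) := by gcongr
          _ = _ := by ring
      exact Nat.le_of_mul_le_mul_right h4 (by omega)
    calc N' * m ^ (X.card + 1) = (N' * m) * m ^ X.card := by ring
      _ ≤ (N * Y.card) * m ^ X.card := by gcongr
      _ = (N * m ^ X.card) * Y.card := by ring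
      _ ≤ (m.factorial * Y.card ^ X.card) * Y.card := by gcongr
      _ = _ := by ring

end AKS

namespace AKS

lemma choose_mul_pow_le (m y : ℕ) (hm : 1 ≤ m) :
    (m.choose y : ℝ) * ((y : ℝ) / m) ^ y ≤ Real.exp y := by
  have h1 : (m.choose y : ℝ) ≤ (m : ℝ) ^ y / y.factorial := Nat.choose_le_pow_div y m
  have h2 : (y : ℝ) ^ y / y.factorial ≤ Real.exp y := Real.pow_div_factorial_le_exp _ (by positivity) _
  have hm' : (0 : ℝ) < m := by exact_mod_cast hm
  calc (m.choose y : ℝ) * ((y : ℝ) / m) ^ y ≤ (m : ℝ) ^ y / y.factorial * ((y : ℝ) / m) ^ y := by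
        gcongr
    _ = (y : ℝ) ^ y / y.factorial := by rw [div_pow]; field_simp
    _ ≤ _ := h2

lemma term_bound (K m r y E : ℕ) (hK : 1 ≤ K) (hr : 1 ≤ r) (hy : 1 ≤ y) (hyK : y ≤ K * r)
    (hm : r + y ≤ m) :
    (m.choose r : ℝ) * (m.choose y) * ((y : ℝ) / m) ^ (r * (K + 1 + E)) ≤
      (Real.exp 1 * K * Real.exp K * ((K : ℝ) / (K + 1)) ^ E) ^ r := by
  have hm1 : 1 ≤ m := by omega
  have hm' : (0 : ℝ) < m := by exact_mod_cast hm1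
  have hr' : (0 : ℝ) < r := by exact_mod_cast hr
  have hy' : (0 : ℝ) < y := by exact_mod_cast hy
  have hyK' : (y : ℝ) ≤ K * r := by exact_mod_cast hyK
  have hmm : (r : ℝ) + y ≤ m := by exact_mod_cast hm
  set θ := (y : ℝ) / m with hθ
  have hθ0 : 0 ≤ θ := by positivity
  have hθ1 : θ ≤ 1 := by rw [hθ, div_le_one hm']; linarith
  have hθ2 : θ ≤ (K : ℝ) / (K + 1) := by
    rw [hθ, div_le_div_iff₀ hm' (by positivity)]
    have : (K : ℝ) * (r + y) ≤ K * m := by gcongr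
    nlinarith
  have a1 : (m.choose r : ℝ) * θ ^ r ≤ (Real.exp 1 * K) ^ r := by
    have h := choose_mul_pow_le m r hm1
    have e1 : θ ^ r = ((r : ℝ) / m) ^ r * ((y : ℝ) / r) ^ r := by
      rw [← mul_pow]; congr 1; rw [hθ]; field_simp
    rw [e1, mul_pow, ← mul_assoc, ← Real.exp_nat_mul, mul_one]
    have : (y : ℝ) / r ≤ K := by rw [div_le_iff₀ hr']; exact hyK'
    gcongr
  have a2 : (m.choose y : ℝ) * θ ^ (K * r) ≤ (Real.exp K) ^ r := by
    have h := choose_mul_pow_le m y hm1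
    calc (m.choose y : ℝ) * θ ^ (K * r) ≤ (m.choose y : ℝ) * θ ^ y := by
          gcongr ?_ * ?_
          exact pow_le_pow_of_le_one hθ0 hθ1 hyK
      _ ≤ Real.exp y := h
      _ ≤ Real.exp (r * K) := by
        apply Real.exp_le_exp.mpr; linarith
      _ = _ := by rw [Real.exp_nat_mul]
  have a3 : θ ^ (E * r) ≤ (((K : ℝ) / (K + 1)) ^ E) ^ r := by
    rw [← pow_mul]; gcongr
  calc (m.choose r : ℝ) * (m.choose y) * θ ^ (r * (K + 1 + E))
      = ((m.choose r : ℝ) * θ ^ r) * ((m.choose y : ℝ) * θ ^ (K * r)) * θ ^ (E * r) := by ring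
    _ ≤ (Real.exp 1 * K) ^ r * (Real.exp K) ^ r * (((K : ℝ) / (K + 1)) ^ E) ^ r := by gcongr
    _ = _ := by rw [← mul_pow, ← mul_pow]

lemma sum_bound (K : ℕ) (hK : 1 ≤ K) : ∃ d : ℕ, ∀ m : ℕ,
    ∑ r ∈ range (m + 1), ∑ y ∈ range (m + 1), (m.choose r : ℝ) * ((m.choose y : ℝ) *
      (if 1 ≤ r ∧ y ≤ K * r ∧ r + y ≤ m then ((y : ℝ) / m) ^ (r * d) else 0)) < 1 := by
  have hK' : (1 : ℝ) ≤ K := by exact_mod_cast hK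
  have hpos : (0 : ℝ) < Real.exp 1 * K * Real.exp K := by positivity
  obtain ⟨E, hE⟩ := exists_pow_lt_of_lt_one (x := 1 / (Real.exp 1 * K * Real.exp K * (6 * K)))
    (y := (K : ℝ) / (K + 1)) (by positivity) (by rw [div_lt_one (by positivity)]; linarith)
  refine ⟨K + 1 + E, fun m => ?_⟩
  set c := Real.exp 1 * K * Real.exp K * ((K : ℝ) / (K + 1)) ^ E with hc
  have hc0 : 0 ≤ c := by positivity
  have hc1 : c * (6 * K) ≤ 1 := by
    rw [lt_div_iff₀ (by positivity)] at hE
    rw [hc]; nlinarith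
  have hin : ∀ r ∈ range (m + 1), ∑ y ∈ range (m + 1), (m.choose r : ℝ) * ((m.choose y : ℝ) *
      (if 1 ≤ r ∧ y ≤ K * r ∧ r + y ≤ m then ((y : ℝ) / m) ^ (r * (K + 1 + E)) else 0))
      ≤ if r = 0 then 0 else (1 / 3 : ℝ) ^ r := by
    intro r _
    by_cases hr : r = 0
    · subst hr; simp
    rw [if_neg hr]
    have hr1 : 1 ≤ r := by omega
    have hp : ∀ y ∈ range (m + 1), (m.choose r : ℝ) * ((m.choose y : ℝ) *
      (if 1 ≤ r ∧ y ≤ K * r ∧ r + y ≤ m then ((y : ℝ) / m) ^ (r * (K + 1 + E)) else 0))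
        ≤ if y ∈ Icc 1 (K * r) then c ^ r else 0 := by
      intro y _
      split_ifs with h1 h2 h2
      · rw [mem_Icc] at h2
        rw [← mul_assoc]
        exact term_bound K m r y E hK hr1 h2.1 h1.2.1 h1.2.2
      · have : y = 0 := by
          rw [mem_Icc] at h2; omega
        subst this
        have : r * (K + 1 + E) ≠ 0 := by positivity
        simp [this]
      · simp; positivity
      · simp
    refine (sum_le_sum hp).trans ?_
    rw [← sum_filter]
    refine (sum_le_sum_of_subset_of_nonneg (t := Icc 1 (K * r)) (by intro y; simp)
      (fun _ _ _ => by positivity)).trans ?_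
    rw [sum_const, Nat.card_Icc, nsmul_eq_mul]
    have h2 : (r : ℝ) ≤ 2 ^ r := by exact_mod_cast (Nat.lt_two_pow_self).le
    have h3 : (K : ℝ) ≤ K ^ r := le_self_pow₀ hK' hr
    calc ((K * r + 1 - 1 : ℕ) : ℝ) * c ^ r = K * r * c ^ r := by push_cast; simp
      _ ≤ K ^ r * 2 ^ r * c ^ r := by gcongr
      _ = (K * 2 * c) ^ r := by rw [mul_pow ((K : ℝ) * 2) c, mul_pow (K : ℝ) 2]
      _ ≤ (1 / 3) ^ r := by
        gcongr; linarith
  refine (sum_le_sum hin).trans_lt ?_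
  have : ∀ m : ℕ, ∑ r ∈ range (m + 1), (if r = 0 then 0 else (1 / 3 : ℝ) ^ r)
      = (1 - (1 / 3) ^ m) / 2 := by
    intro m
    induction m with
    | zero => simp
    | succ m ih => rw [sum_range_succ, ih]; simp; ring
  rw [this]
  have : (0 : ℝ) < (1 / 3) ^ m := by positivity
  linarith

lemma expander (K : ℕ) (hK : 1 ≤ K) : ∃ d : ℕ, ∀ m : ℕ, ∃ P : Fin d → Equiv.Perm (Fin m),
    ∀ X Y : Finset (Fin m), 1 ≤ X.card → Y.card ≤ K * X.card → X.card + Y.card ≤ m →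
      ∃ j, ¬ ∀ x ∈ X, P j x ∈ Y := by
  classical
  obtain ⟨d, hd⟩ := sum_bound K hK
  refine ⟨d, fun m => ?_⟩
  by_contra hcon
  push Not at hcon
  have hlt := hd m
  let N : Finset (Fin m) → Finset (Fin m) → Finset (Equiv.Perm (Fin m)) :=
    fun X Y => univ.filter fun π => ∀ x ∈ X, π x ∈ Y
  let cond : Finset (Fin m) → Finset (Fin m) → Prop := fun X Y =>
    1 ≤ X.card ∧ Y.card ≤ K * X.card ∧ X.card + Y.card ≤ m
  let F : Finset (Fin m) × Finset (Fin m) → Finset (Fin d → Equiv.Perm (Fin m)) := fun z =>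
    if cond z.1 z.2 then Fintype.piFinset fun _ => N z.1 z.2 else ∅
  have hcov : (univ : Finset (Fin d → Equiv.Perm (Fin m))) ⊆ (univ ×ˢ univ).biUnion F := by
    intro P _
    obtain ⟨X, Y, h1, h2, h3, h4⟩ := hcon P
    rw [mem_biUnion]
    refine ⟨(X, Y), by simp, ?_⟩
    have : cond X Y := ⟨h1, h2, h3⟩
    simp only [F, this, if_true, Fintype.mem_piFinset, N, mem_filter, mem_univ, true_and]
    exact h4
  have hcard := (card_le_card hcov).trans card_biUnion_le
  rw [card_univ, Fintype.card_fun, Fintype.card_perm, Fintype.card_fin, Fintype.card_fin,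
    sum_product] at hcard
  have hfac : (0 : ℝ) < (m.factorial : ℝ) ^ d := by positivity
  have hterm : ∀ X Y : Finset (Fin m), ((F (X, Y)).card : ℝ) ≤ (m.factorial : ℝ) ^ d *
      (if cond X Y then ((Y.card : ℝ) / m) ^ (X.card * d) else 0) := by
    intro X Y
    by_cases h : cond X Y
    · have hm : (0 : ℝ) < m := by
        have : 1 ≤ m := by have := h.1; have := h.2.2; omega
        exact_mod_cast this
      simp only [F, h, if_true, Fintype.card_piFinset_const, Nat.cast_pow]
      rw [pow_mul, ← mul_pow]
      gcongr
      have h1 : ((N X Y).card : ℝ) * (m : ℝ) ^ X.card ≤ m.factorial * (Y.card : ℝ) ^ X.card := by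
        exact_mod_cast perm_count Y X
      rw [div_pow, ← mul_div_assoc, le_div_iff₀ (by positivity)]
      exact h1
    · simp [F, h]
  have h2 : (m.factorial : ℝ) ^ d ≤ (m.factorial : ℝ) ^ d * ∑ X : Finset (Fin m),
      ∑ Y : Finset (Fin m), (if cond X Y then ((Y.card : ℝ) / m) ^ (X.card * d) else 0) := by
    calc (m.factorial : ℝ) ^ d ≤ ∑ X : Finset (Fin m), ∑ Y : Finset (Fin m), ((F (X, Y)).card : ℝ) := by
          exact_mod_cast hcard
      _ ≤ _ := by
        rw [mul_sum]
        apply sum_le_sum; intro X _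
        rw [mul_sum]
        apply sum_le_sum; intro Y _
        exact hterm X Y
  have h3 : ∑ X : Finset (Fin m), ∑ Y : Finset (Fin m),
      (if cond X Y then ((Y.card : ℝ) / m) ^ (X.card * d) else 0) = 
      ∑ r ∈ range (m + 1), ∑ y ∈ range (m + 1), (m.choose r : ℝ) * ((m.choose y : ℝ) *
      (if 1 ≤ r ∧ y ≤ K * r ∧ r + y ≤ m then ((y : ℝ) / m) ^ (r * d) else 0)) := by
    have hY : ∀ X : Finset (Fin m), ∑ Y : Finset (Fin m),
      (if cond X Y then ((Y.card : ℝ) / m) ^ (X.card * d) else 0) =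
       ∑ y ∈ range (m + 1), ((m.choose y : ℝ) *
      (if 1 ≤ X.card ∧ y ≤ K * X.card ∧ X.card + y ≤ m then ((y : ℝ) / m) ^ (X.card * d) else 0)) := by
      intro X
      have := sum_powerset_apply_card (fun y => (if 1 ≤ X.card ∧ y ≤ K * X.card ∧ X.card + y ≤ m then ((y : ℝ) / m) ^ (X.card * d) else 0)) (x := (univ : Finset (Fin m)))
      rw [powerset_univ, card_univ, Fintype.card_fin] at this
      simp only [nsmul_eq_mul] at this
      rw [← this]
    simp_rw [hY]
    have := sum_powerset_apply_card (fun r => ∑ y ∈ range (m + 1), ((m.choose y : ℝ) *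
      (if 1 ≤ r ∧ y ≤ K * r ∧ r + y ≤ m then ((y : ℝ) / m) ^ (r * d) else 0))) (x := (univ : Finset (Fin m)))
    rw [powerset_univ, card_univ, Fintype.card_fin] at this
    simp only [nsmul_eq_mul] at this
    rw [this]
    simp_rw [mul_sum]
  rw [h3] at h2
  nlinarith

end AKS

namespace AKS

/-- number of positions carrying the value `b` -/
def cnt {W : Type*} [Fintype W] (b : Bool) (y : W → Bool) : ℕ := (univ.filter fun w => y w = b).card

lemma cnt_run {W : Type*} [Fintype W] (b : Bool) (L : List (CS W)) (y : W → Bool) :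
    cnt b (run L y) = cnt b y := run_count L y (fun v => v = b)

def hstage {m : ℕ} (π : Equiv.Perm (Fin m)) : CS (Fin m ⊕ Fin m) where
  σ := Sum.elim (fun i => Sum.inr (π i)) (fun i => Sum.inl (π.symm i))
  mn := Sum.isLeft
  inv := by rintro (i | i) <;> simp
  anti := by rintro (i | i) _ <;> simp

lemma hstage_left {m : ℕ} (Q : List (Equiv.Perm (Fin m))) (y : Fin m ⊕ Fin m → Bool) (i : Fin m) :
    run (Q.map hstage) y (Sum.inl i) ≤ y (Sum.inl i) := by
  induction Q generalizing y with
  | nil => exact le_rfl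
  | cons π Q ih =>
    rw [List.map_cons, run_cons]
    refine (ih _).trans ?_
    exact min_le_left _ _

lemma hstage_right {m : ℕ} (Q : List (Equiv.Perm (Fin m))) (y : Fin m ⊕ Fin m → Bool) (i : Fin m) :
    y (Sum.inr i) ≤ run (Q.map hstage) y (Sum.inr i) := by
  induction Q generalizing y with
  | nil => exact le_rfl
  | cons π Q ih =>
    rw [List.map_cons, run_cons]
    refine le_trans ?_ (ih _)
    exact le_max_left _ _

lemma hstage_edge {m : ℕ} (Q : List (Equiv.Perm (Fin m))) (y : Fin m ⊕ Fin m → Bool) (i : Fin m)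
    (π : Equiv.Perm (Fin m)) (hπ : π ∈ Q) :
    run (Q.map hstage) y (Sum.inl i) ≤ run (Q.map hstage) y (Sum.inr (π i)) := by
  induction Q generalizing y with
  | nil => simp at hπ
  | cons ρ Q ih =>
    rw [List.map_cons, run_cons]
    rcases List.mem_cons.mp hπ with rfl | h
    · refine (hstage_left _ _ _).trans (le_trans ?_ (hstage_right _ _ _))
      exact (min_le_right _ _).trans (le_max_left _ _)
    · exact ih _ h

lemma cnt_sum {m : ℕ} (b : Bool) (y : Fin m ⊕ Fin m → Bool) :
    cnt b y = (univ.filter fun i => y (Sum.inl i) = b).card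
      + (univ.filter fun i => y (Sum.inr i) = b).card := by
  simp only [cnt, card_filter, Fintype.sum_sum_type]

lemma halver (K : ℕ) (hK : 1 ≤ K) : ∃ d : ℕ, ∀ m : ℕ, ∃ L : List (CS (Fin m ⊕ Fin m)),
    L.length = d ∧ (∀ s ∈ L, ∀ u, s.mn u = Sum.isLeft u ∧ Sum.isLeft (s.σ u) = !Sum.isLeft u) ∧
    (∀ y : Fin m ⊕ Fin m → Bool, cnt false y ≤ m →
      (K + 1) * (univ.filter fun i => run L y (Sum.inr i) = false).card ≤ cnt false y) ∧
    (∀ y : Fin m ⊕ Fin m → Bool, cnt true y ≤ m →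
      (K + 1) * (univ.filter fun i => run L y (Sum.inl i) = true).card ≤ cnt true y) := by
  obtain ⟨d, hd⟩ := expander K hK
  refine ⟨d + d, fun m => ?_⟩
  obtain ⟨P, hP⟩ := hd m
  set Q := List.ofFn P ++ List.ofFn (fun j => (P j).symm) with hQ
  refine ⟨Q.map hstage, by simp [hQ], ?_, ?_, ?_⟩
  · intro s hs u
    obtain ⟨π, _, rfl⟩ := List.mem_map.mp hs
    rcases u with u | u <;> simp [hstage]
  · intro y hy
    rw [← cnt_run false (Q.map hstage), cnt_sum] at hy ⊢
    set Y := univ.filter fun i => run (Q.map hstage) y (Sum.inl i) = false with hY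
    set X := univ.filter fun i => run (Q.map hstage) y (Sum.inr i) = false with hX
    by_contra hcon
    have h1 : 1 ≤ X.card := by
      by_contra h; have : X.card = 0 := by omega
      rw [this] at hcon; omega
    obtain ⟨j, hj⟩ := hP X Y h1 (by nlinarith) (by omega)
    apply hj
    intro x hx
    have := hstage_edge Q y (P j x) (P j).symm (by simp [hQ])
    rw [Equiv.symm_apply_apply] at this
    have hx' := (mem_filter.mp hx).2
    rw [hx'] at this
    simp only [hY, mem_filter, mem_univ, true_and]
    exact le_bot_iff.mp this
  · intro y hy
    rw [← cnt_run true (Q.map hstage), cnt_sum] at hy ⊢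
    set X := univ.filter fun i => run (Q.map hstage) y (Sum.inl i) = true with hX
    set Y := univ.filter fun i => run (Q.map hstage) y (Sum.inr i) = true with hY
    by_contra hcon
    have h1 : 1 ≤ X.card := by
      by_contra h; have : X.card = 0 := by omega
      rw [this] at hcon; omega
    obtain ⟨j, hj⟩ := hP X Y h1 (by nlinarith) (by omega)
    apply hj
    intro x hx
    have := hstage_edge Q y x (P j) (by simp [hQ])
    have hx' := (mem_filter.mp hx).2
    rw [hx'] at this
    simp only [hY, mem_filter, mem_univ, true_and]
    exact top_le_iff.mp this

/-! standard networks -/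
def Std {x : ℕ} (s : CS (Fin x)) : Prop := ∀ p, s.σ p ≠ p → s.mn p = true → p < s.σ p

def leakLo {x : ℕ} (f : ℕ) (y : Fin x → Bool) : ℕ := (univ.filter fun p : Fin x => f ≤ p.1 ∧ y p = false).card
def leakHi {x : ℕ} (f : ℕ) (y : Fin x → Bool) : ℕ := (univ.filter fun p : Fin x => p.1 < f ∧ y p = true).card

lemma Std.lt' {x : ℕ} {s : CS (Fin x)} (h : Std s) (p : Fin x) (hp : s.σ p ≠ p) (hm : s.mn p = false) :
    s.σ p < p := by
  have h1 := s.anti p hp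
  have := h (s.σ p) (by rw [s.inv]; exact hp.symm) (by rw [h1, hm]; rfl)
  rwa [s.inv] at this

lemma std_leakLo {x : ℕ} (f : ℕ) (s : CS (Fin x)) (hs : Std s) (y : Fin x → Bool) :
    leakLo f (s.app y) ≤ leakLo f y := by
  apply card_le_card_of_injOn (fun q => if y q = false then q else s.σ q)
  · intro q hq
    simp only [coe_filter, mem_univ, true_and, Set.mem_ofPred_eq] at hq ⊢
    split_ifs with h
    · exact ⟨hq.1, h⟩
    · have h2 := hq.2
      unfold CS.app at h2
      have hy : y q = true := by simpa using h
      cases hm : s.mn q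
      · rw [hm, hy] at h2; simp at h2
      · rw [hm, hy] at h2
        have h3 : y (s.σ q) = false := by simpa using h2
        refine ⟨?_, h3⟩
        have hne : s.σ q ≠ q := by intro e; rw [e, hy] at h3; simp at h3
        have := hs q hne hm
        have := hq.1
        omega
  · have key : ∀ q, s.app y q = false → y q = true → s.app y (s.σ q) = false → y (s.σ q) = false → False := by
      intro q h1 h2 h3 h4
      have hne : s.σ q ≠ q := by intro e; rw [e, h2] at h4; simp at h4
      unfold CS.app at h1 h3
      rw [s.anti q hne, s.inv, h2, h4] at h3
      rw [h2, h4] at h1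
      cases hm : s.mn q <;> simp [hm] at h1 h3
    intro q hq q' hq' e
    simp only [coe_filter, mem_univ, true_and, Set.mem_ofPred_eq] at hq hq' e
    split_ifs at e with h h' h'
    · exact e
    · subst e
      exact (key q' hq'.2 (by simpa using h') hq.2 h).elim
    · subst e
      exact (key q hq.2 (by simpa using h) hq'.2 h').elim
    · have := congrArg s.σ e
      rwa [s.inv, s.inv] at this

lemma std_leakHi {x : ℕ} (f : ℕ) (s : CS (Fin x)) (hs : Std s) (y : Fin x → Bool) :
    leakHi f (s.app y) ≤ leakHi f y := by
  apply card_le_card_of_injOn (fun q => if y q = true then q else s.σ q)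
  · intro q hq
    simp only [coe_filter, mem_univ, true_and, Set.mem_ofPred_eq] at hq ⊢
    split_ifs with h
    · exact ⟨hq.1, h⟩
    · have h2 := hq.2
      unfold CS.app at h2
      have hy : y q = false := by simpa using h
      cases hm : s.mn q
      · rw [hm, hy] at h2
        have h3 : y (s.σ q) = true := by simpa using h2
        refine ⟨?_, h3⟩
        have hne : s.σ q ≠ q := by intro e; rw [e, hy] at h3; simp at h3
        have := hs.lt' q hne hm
        have := hq.1
        omega
      · rw [hm, hy] at h2; simp at h2
  · have key : ∀ q, s.app y q = true → y q = false → s.app y (s.σ q) = true → y (s.σ q) = true → False := by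
      intro q h1 h2 h3 h4
      have hne : s.σ q ≠ q := by intro e; rw [e, h2] at h4; simp at h4
      unfold CS.app at h1 h3
      rw [s.anti q hne, s.inv, h2, h4] at h3
      rw [h2, h4] at h1
      cases hm : s.mn q <;> simp [hm] at h1 h3
    intro q hq q' hq' e
    simp only [coe_filter, mem_univ, true_and, Set.mem_ofPred_eq] at hq hq' e
    split_ifs at e with h h' h'
    · exact e
    · subst e
      exact (key q' hq'.2 (by simpa using h') hq.2 h).elim
    · subst e
      exact (key q hq.2 (by simpa using h) hq'.2 h').elim
    · have := congrArg s.σ e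
      rwa [s.inv, s.inv] at this

lemma std_run_leakLo {x : ℕ} (f : ℕ) (L : List (CS (Fin x))) (hL : ∀ s ∈ L, Std s) (y : Fin x → Bool) :
    leakLo f (run L y) ≤ leakLo f y := by
  induction L generalizing y with
  | nil => exact le_rfl
  | cons s L ih =>
    exact (ih (fun s hs => hL s (List.mem_cons_of_mem _ hs)) _).trans (std_leakLo f s (hL s (by simp)) y)

lemma std_run_leakHi {x : ℕ} (f : ℕ) (L : List (CS (Fin x))) (hL : ∀ s ∈ L, Std s) (y : Fin x → Bool) :
    leakHi f (run L y) ≤ leakHi f y := by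
  induction L generalizing y with
  | nil => exact le_rfl
  | cons s L ih =>
    exact (ih (fun s hs => hL s (List.mem_cons_of_mem _ hs)) _).trans (std_leakHi f s (hL s (by simp)) y)

/-- iterate a halver over chunks -/
noncomputable def iter {U W : Type*} (L : List (CS U)) (ι : ℕ → U ↪ W) : ℕ → List (CS W)
  | 0 => []
  | R + 1 => iter L ι R ++ L.map (embed (ι R))

lemma iter_length {U W : Type*} (L : List (CS U)) (ι : ℕ → U ↪ W) (R : ℕ) :
    (iter L ι R).length = R * L.length := by
  induction R with
  | zero => simp [iter]
  | succ R ih => simp [iter, ih]; ring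

lemma iter_std {x f : ℕ} (L : List (CS (Fin f ⊕ Fin f))) (ι : ℕ → (Fin f ⊕ Fin f) ↪ Fin x) (R : ℕ)
    (hL : ∀ s ∈ L, ∀ u, s.mn u = Sum.isLeft u ∧ Sum.isLeft (s.σ u) = !Sum.isLeft u)
    (hι : ∀ r i j, ι r (Sum.inl i) < ι r (Sum.inr j)) :
    ∀ s ∈ iter L ι R, Std s := by
  induction R with
  | zero => simp [iter]
  | succ R ih =>
    intro s hs
    rw [iter, List.mem_append] at hs
    rcases hs with hs | hs
    · exact ih s hs
    · obtain ⟨s', hs', rfl⟩ := List.mem_map.mp hs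
      intro p hp hm
      by_cases h : ∃ u, ι R u = p
      · obtain ⟨u, rfl⟩ := h
        rw [embed_mn, (hL s' hs' u).1] at hm
        have h2 := (hL s' hs' u).2
        rw [embed_σ]
        rcases u with u | u
        · rcases h3 : s'.σ (Sum.inl u) with v | v
          · rw [h3] at h2; simp at h2
          · exact hι R u v
        · simp at hm
      · push Not at h
        exact absurd (embed_σ_off (ι R) s' p h) hp

lemma iter_leak {x f K : ℕ} (b : Bool) (L : List (CS (Fin f ⊕ Fin f)))
    (cf : Fin f → Fin f ⊕ Fin f)
    (hL : ∀ y : Fin f ⊕ Fin f → Bool, cnt b y ≤ f →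
      (K + 1) * (univ.filter fun i => run L y (cf i) = b).card ≤ cnt b y)
    (ι : ℕ → (Fin f ⊕ Fin f) ↪ Fin x) (T : Finset (Fin x))
    (hT : ∀ r u, ι r u ∈ T → ∃ i, u = cf i)
    (y : Fin x → Bool) (hy : cnt b y ≤ f) (R : ℕ) :
    (K + 1) * (univ.filter fun p => p ∈ T ∧ (∃ r < R, ∃ i, ι r (cf i) = p) ∧
      run (iter L ι R) y p = b).card ≤ R * cnt b y := by
  classical
  induction R with
  | zero => simp
  | succ R ih =>
    rw [iter, run_append]
    set y' := run (iter L ι R) y with hy'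
    set A := univ.filter fun p => p ∈ T ∧ (∃ r < R, ∃ i, ι r (cf i) = p) ∧ y' p = b
    have hc : cnt b (fun u => y' (ι R u)) ≤ cnt b y := by
      rw [← cnt_run b (iter L ι R) y]
      exact card_le_card_of_injOn (ι R) (by intro u; simp [hy']) ((ι R).injective.injOn)
    have h1 := hL (fun u => y' (ι R u)) (hc.trans hy)
    set B := univ.filter fun i => run L (fun u => y' (ι R u)) (cf i) = b
    have hsub : (univ.filter fun p => p ∈ T ∧ (∃ r < R + 1, ∃ i, ι r (cf i) = p) ∧
      run (L.map (embed (ι R))) y' p = b) ⊆ A ∪ B.image (fun i => ι R (cf i)) := by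
      intro p hp
      simp only [mem_filter, mem_univ, true_and] at hp
      obtain ⟨hpT, ⟨r, hr, i, hi⟩, hpb⟩ := hp
      rw [mem_union, mem_image]
      by_cases h : ∃ u, ι R u = p
      · right
        obtain ⟨u, hu⟩ := h
        obtain ⟨j, hj⟩ := hT R u (hu ▸ hpT)
        refine ⟨j, ?_, by rw [← hj, hu]⟩
        simp only [B, mem_filter, mem_univ, true_and]
        rw [← embed_run (ι R) L y', ← hj]
        change run (L.map (embed (ι R))) y' (ι R u) = b
        rw [hu]
        exact hpb
      · left
        push Not at h
        rw [embed_run_off _ _ _ _ h] at hpb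
        simp only [A, mem_filter, mem_univ, true_and]
        refine ⟨hpT, ⟨r, ?_, i, hi⟩, hpb⟩
        rcases Nat.lt_succ_iff_lt_or_eq.mp hr with h2 | h2
        · exact h2
        · subst h2; exact absurd hi (h _)
    have h2 := (card_le_card hsub).trans ((card_union_le _ _).trans (Nat.add_le_add_left card_image_le _))
    calc _ ≤ (K + 1) * (A.card + B.card) := Nat.mul_le_mul_left _ h2
      _ = (K + 1) * A.card + (K + 1) * B.card := by ring
      _ ≤ R * cnt b y + cnt b y := by omega
      _ = _ := by ring

lemma iter_leak' {x f K : ℕ} (b : Bool) (L : List (CS (Fin f ⊕ Fin f)))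
    (cf : Fin f → Fin f ⊕ Fin f)
    (hL : ∀ y : Fin f ⊕ Fin f → Bool, cnt b y ≤ f →
      (K + 1) * (univ.filter fun i => run L y (cf i) = b).card ≤ cnt b y)
    (ι : ℕ → (Fin f ⊕ Fin f) ↪ Fin x) (T : Finset (Fin x))
    (hT : ∀ r u, ι r u ∈ T → ∃ i, u = cf i)
    (y : Fin x → Bool) (hy : cnt b y ≤ f) (R : ℕ) (Z : Finset (Fin x))
    (hZ : ∀ p ∈ Z, p ∈ T ∧ (∃ r < R, ∃ i, ι r (cf i) = p) ∧ run (iter L ι R) y p = b) :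
    (K + 1) * Z.card ≤ R * cnt b y := by
  classical
  refine le_trans (Nat.mul_le_mul_left _ (card_le_card ?_)) (iter_leak b L cf hL ι T hT y hy R)
  intro p hp
  exact mem_filter.mpr ⟨mem_univ _, hZ p hp⟩

lemma gather : ∃ q : ℕ, ∀ x f : ℕ, 2 * f ≤ x → (f = 0 ∨ x ≤ 256 * f) →
    ∃ L : List (CS (Fin x)), L.length = q ∧ (∀ s ∈ L, Std s) ∧
    (∀ y, cnt false y ≤ f → 256 * leakLo f (run L y) ≤ cnt false y) ∧
    (∀ y, cnt true y ≤ f → 256 * leakHi (x - f) (run L y) ≤ cnt true y) := by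
  obtain ⟨d, hd⟩ := halver 65535 (by norm_num)
  refine ⟨256 * d + 256 * d, fun x f hfx hf => ?_⟩
  by_cases hf0 : f = 0
  · subst hf0
    refine ⟨List.replicate (256 * d + 256 * d) (idle _), by simp, ?_, ?_, ?_⟩
    · intro s hs p hp
      rw [List.eq_of_mem_replicate hs] at hp
      exact absurd rfl hp
    · intro y hy
      have : leakLo 0 y ≤ cnt false y := card_le_card (by intro p; simp)
      rw [run_idle]; omega
    · intro y hy
      have : leakHi (x - 0) y ≤ cnt true y := card_le_card (by intro p; simp)
      rw [run_idle]; omega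
  have hf1 : 0 < f := by omega
  have hx : x ≤ 256 * f := by omega
  obtain ⟨H, hlen, hstd, hlo, hhi⟩ := hd f
  let ι₁ : ℕ → (Fin f ⊕ Fin f) ↪ Fin x := fun r =>
    ⟨Sum.elim (fun i => ⟨i.1, by omega⟩) (fun i => ⟨min (f + r * f) (x - f) + i.1, by omega⟩), by
      rintro (i | i) (j | j) h
      all_goals
        simp only [Sum.elim_inl, Sum.elim_inr, Fin.mk.injEq] at h
      · exact congrArg _ (Fin.ext h)
      · exfalso; generalize r * f = z at h; omega
      · exfalso; generalize r * f = z at h; omega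
      · exact congrArg _ (Fin.ext (by omega))⟩
  let ι₂ : ℕ → (Fin f ⊕ Fin f) ↪ Fin x := fun r =>
    ⟨Sum.elim (fun i => ⟨min (r * f) (x - 2 * f) + i.1, by omega⟩) (fun i => ⟨x - f + i.1, by omega⟩), by
      rintro (i | i) (j | j) h
      all_goals
        simp only [Sum.elim_inl, Sum.elim_inr, Fin.mk.injEq] at h
      · exact congrArg _ (Fin.ext (by omega))
      · exfalso; generalize r * f = z at h; omega
      · exfalso; generalize r * f = z at h; omega
      · exact congrArg _ (Fin.ext (by omega))⟩
  have v1l : ∀ r i, (ι₁ r (Sum.inl i)).1 = i.1 := fun _ _ => rfl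
  have v1r : ∀ r i, (ι₁ r (Sum.inr i)).1 = min (f + r * f) (x - f) + i.1 := fun _ _ => rfl
  have v2l : ∀ r i, (ι₂ r (Sum.inl i)).1 = min (r * f) (x - 2 * f) + i.1 := fun _ _ => rfl
  have v2r : ∀ r i, (ι₂ r (Sum.inr i)).1 = x - f + i.1 := fun _ _ => rfl
  have s1 : ∀ s ∈ iter H ι₁ 256, Std s := iter_std H ι₁ 256 hstd (by
    intro r i j; rw [Fin.lt_def, v1l, v1r]; generalize r * f = z; omega)
  have s2 : ∀ s ∈ iter H ι₂ 256, Std s := iter_std H ι₂ 256 hstd (by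
    intro r i j; rw [Fin.lt_def, v2l, v2r]; generalize r * f = z; omega)
  refine ⟨iter H ι₁ 256 ++ iter H ι₂ 256, ?_, ?_, ?_, ?_⟩
  · rw [List.length_append, iter_length, iter_length, hlen]
  · intro s hs
    rcases List.mem_append.mp hs with h | h
    · exact s1 s h
    · exact s2 s h
  · intro y hy
    rw [run_append]
    refine (Nat.mul_le_mul_left _ (std_run_leakLo f _ s2 _)).trans ?_
    have h := iter_leak' false H Sum.inr hlo ι₁ (univ.filter fun p => f ≤ p.1) (by
      rintro r (i | i) h
      · rw [mem_filter, v1l] at h; omega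
      · exact ⟨i, rfl⟩) y hy 256
    have h2 := h (univ.filter fun p => f ≤ p.1 ∧ run (iter H ι₁ 256) y p = false) (by
      intro p hp
      simp only [mem_filter, mem_univ, true_and] at hp ⊢
      refine ⟨hp.1, ?_, hp.2⟩
      have hmod := Nat.div_add_mod (p.1 - f) f
      have hlt := Nat.mod_lt (p.1 - f) hf1
      have hdlt : (p.1 - f) / f < 256 := by
        rw [Nat.div_lt_iff_lt_mul hf1]; omega
      rw [mul_comm] at hmod
      refine ⟨(p.1 - f) / f, hdlt, ?_⟩
      generalize hz : (p.1 - f) / f * f = z at hmod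
      have hp1 := hp.1
      refine ⟨⟨p.1 - min (f + z) (x - f), by omega⟩, ?_⟩
      apply Fin.ext
      rw [v1r, hz]
      simp only
      omega)
    first | unfold leakLo | unfold leakHi
    omega
  · intro y hy
    rw [run_append]
    rw [← cnt_run true (iter H ι₁ 256) y] at hy ⊢
    set y' := run (iter H ι₁ 256) y
    have h := iter_leak' true H Sum.inl hhi ι₂ (univ.filter fun p => p.1 < x - f) (by
      rintro r (i | i) h
      · exact ⟨i, rfl⟩
      · rw [mem_filter, v2r] at h; omega) y' hy 256
    have h2 := h (univ.filter fun p => p.1 < x - f ∧ run (iter H ι₂ 256) y' p = true) (by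
      intro p hp
      simp only [mem_filter, mem_univ, true_and] at hp ⊢
      refine ⟨hp.1, ?_, hp.2⟩
      have hmod := Nat.div_add_mod p.1 f
      have hlt := Nat.mod_lt p.1 hf1
      have hdlt : p.1 / f < 256 := by
        rw [Nat.div_lt_iff_lt_mul hf1]; omega
      rw [mul_comm] at hmod
      refine ⟨p.1 / f, hdlt, ?_⟩
      generalize hz : p.1 / f * f = z at hmod
      have hp1 := hp.1
      refine ⟨⟨p.1 - min z (x - 2 * f), by omega⟩, ?_⟩
      apply Fin.ext
      rw [v2l, hz]
      simp only
      omega)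
    first | unfold leakLo | unfold leakHi
    omega

/-- from few to arbitrarily many small keys -/
lemma lo_general {x H : ℕ} (hHx : H ≤ x) (L : List (CS (Fin x)))
    (h : ∀ y, cnt false y ≤ H → 256 * leakLo H (run L y) ≤ cnt false y) (y : Fin x → Bool) :
    256 * leakLo H (run L y) ≤ 256 * (cnt false y - H) + H := by
  classical
  by_cases hc : cnt false y ≤ H
  · have := h y hc; omega
  push Not at hc
  obtain ⟨S, hS, hSc⟩ := exists_subset_card_eq (s := univ.filter fun w => y w = false) hc.le
  let z : Fin x → Bool := fun p => decide (p ∉ S)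
  have hz : cnt false z = H := by rw [← hSc]; unfold cnt; congr 1; ext p; simp [z]
  have hyz : ∀ p, y p ≤ z p := by
    intro p
    by_cases hp : p ∈ S
    · have := (mem_filter.mp (hS hp)).2
      rw [this]; exact bot_le
    · simp only [z, hp]; exact le_top
  have h1 := h z hz.le
  have hr := run_mono L hyz
  have e : ∀ y : Fin x → Bool, leakLo H y + (univ.filter fun p : Fin x => p.1 < H ∧ y p = false).card = cnt false y := by
    intro y
    unfold leakLo cnt
    rw [← card_union_of_disjoint]
    · congr 1; ext p; simp only [mem_union, mem_filter, mem_univ, true_and]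
      have := le_or_gt H p.1
      tauto
    · rw [disjoint_left]; intro p; simp only [mem_filter, mem_univ, true_and]; omega
  have e1 := e (run L y)
  have e2 := e (run L z)
  rw [cnt_run] at e1 e2
  have : (univ.filter fun p : Fin x => p.1 < H ∧ run L z p = false).card ≤
      (univ.filter fun p : Fin x => p.1 < H ∧ run L y p = false).card := by
    apply card_le_card
    intro p
    simp only [mem_filter, mem_univ, true_and]
    rintro ⟨h1, h2⟩
    refine ⟨h1, ?_⟩
    have := hr p
    rw [h2] at this
    exact le_bot_iff.mp this
  omega

lemma hi_general {x H : ℕ} (hHx : H ≤ x) (L : List (CS (Fin x)))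
    (h : ∀ y, cnt true y ≤ H → 256 * leakHi (x - H) (run L y) ≤ cnt true y) (y : Fin x → Bool) :
    256 * leakHi (x - H) (run L y) ≤ 256 * (cnt true y - H) + H := by
  classical
  by_cases hc : cnt true y ≤ H
  · have := h y hc; omega
  push Not at hc
  obtain ⟨S, hS, hSc⟩ := exists_subset_card_eq (s := univ.filter fun w => y w = true) hc.le
  let z : Fin x → Bool := fun p => decide (p ∈ S)
  have hz : cnt true z = H := by rw [← hSc]; unfold cnt; congr 1; ext p; simp [z]
  have hyz : ∀ p, z p ≤ y p := by
    intro p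
    by_cases hp : p ∈ S
    · have := (mem_filter.mp (hS hp)).2
      rw [this]; exact le_top
    · simp only [z, hp]; exact bot_le
  have h1 := h z hz.le
  have hr := run_mono L hyz
  have e : ∀ y : Fin x → Bool, leakHi (x - H) y + (univ.filter fun p : Fin x => x - H ≤ p.1 ∧ y p = true).card = cnt true y := by
    intro y
    unfold leakHi cnt
    rw [← card_union_of_disjoint]
    · congr 1; ext p; simp only [mem_union, mem_filter, mem_univ, true_and]
      have := le_or_gt (x - H) p.1
      tauto
    · rw [disjoint_left]; intro p; simp only [mem_filter, mem_univ, true_and]; omega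
  have e1 := e (run L y)
  have e2 := e (run L z)
  rw [cnt_run] at e1 e2
  have : (univ.filter fun p : Fin x => x - H ≤ p.1 ∧ run L z p = true).card ≤
      (univ.filter fun p : Fin x => x - H ≤ p.1 ∧ run L y p = true).card := by
    apply card_le_card
    intro p
    simp only [mem_filter, mem_univ, true_and]
    rintro ⟨h1, h2⟩
    refine ⟨h1, ?_⟩
    have := hr p
    rw [h2] at this
    exact top_le_iff.mp this
  omega

/-- The separator. -/
lemma separator : ∃ q : ℕ, ∀ x f : ℕ, 2 * f ≤ x → (f = 0 ∨ x ≤ 256 * f) →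
    ∃ L : List (CS (Fin x)), L.length = q ∧
    (∀ y, cnt false y ≤ f → 256 * leakLo f (run L y) ≤ cnt false y) ∧
    (∀ y, cnt true y ≤ f → 256 * leakHi (x - f) (run L y) ≤ cnt true y) ∧
    (∀ y, 256 * leakLo (x / 2) (run L y) ≤ 256 * (cnt false y - x / 2) + x / 2) ∧
    (∀ y, 256 * leakHi (x - x / 2) (run L y) ≤ 256 * (cnt true y - x / 2) + x / 2) := by
  obtain ⟨q, hq⟩ := gather
  refine ⟨q + q, fun x f h1 h2 => ?_⟩
  obtain ⟨L, hl, hs, ha, hb⟩ := hq x f h1 h2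
  obtain ⟨M, hl', hs', ha', hb'⟩ := hq x (x / 2) (by omega) (by omega)
  refine ⟨L ++ M, by simp [hl, hl'], ?_, ?_, ?_, ?_⟩
  · intro y hy
    rw [run_append]
    exact (Nat.mul_le_mul_left _ (std_run_leakLo f M hs' _)).trans (ha y hy)
  · intro y hy
    rw [run_append]
    exact (Nat.mul_le_mul_left _ (std_run_leakHi (x - f) M hs' _)).trans (hb y hy)
  · apply lo_general (by omega)
    intro y hy
    rw [run_append]
    rw [← cnt_run false L] at hy ⊢
    exact ha' _ hy
  · apply hi_general (by omega)
    intro y hy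
    rw [run_append]
    rw [← cnt_run true L] at hy ⊢
    exact hb' _ hy

end AKS

namespace AKS

/-- fringe sizes -/
def fr (D t d : ℕ) : ℕ := if d = 0 then 0 else 2 ^ (D + 4 * d) / 2 ^ (t + 8)

/-- bag sizes -/
def xs (D : ℕ) : ℕ → ℕ → ℕ
  | 0, d => if d = 0 then 2 ^ D else 0
  | t + 1, 0 => 2 * (xs D t 1 - 2 * (xs D t 1 / 2 - fr D t 1))
  | t + 1, d + 1 => (xs D t d / 2 - fr D t d) +
      2 * (xs D t (d + 2) - 2 * (xs D t (d + 2) / 2 - fr D t (d + 2)))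

def hh (D t d : ℕ) : ℕ := xs D t d / 2 - fr D t d
def uu (D t d : ℕ) : ℕ := xs D t d - 2 * hh D t d

lemma xs_zero (D d : ℕ) : xs D 0 d = if d = 0 then 2 ^ D else 0 := by
  cases d <;> rfl
lemma xs_root (D t : ℕ) : xs D (t + 1) 0 = 2 * uu D t 1 := rfl
lemma xs_succ (D t d : ℕ) : xs D (t + 1) (d + 1) = hh D t d + 2 * uu D t (d + 2) := rfl

lemma uu_add (D t d : ℕ) : uu D t d + 2 * hh D t d = xs D t d := by
  unfold uu hh; omega

lemma uu_le (D t d : ℕ) : uu D t d ≤ 2 * fr D t d + 1 := by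
  unfold uu hh; omega

lemma xs_big (D t : ℕ) : ∀ d, t < d → xs D t d = 0 := by
  induction t with
  | zero => intro d hd; rw [xs_zero, if_neg (by omega)]
  | succ t ih =>
    intro d hd
    obtain ⟨d, rfl⟩ : ∃ k, d = k + 1 := ⟨d - 1, by omega⟩
    have h1 := ih d (by omega)
    have h2 := ih (d + 2) (by omega)
    rw [xs_succ]; unfold uu hh; omega

lemma xs_odd (D t : ℕ) : ∀ d, (t + d) % 2 = 1 → xs D t d = 0 := by
  induction t with
  | zero => intro d hd; rw [xs_zero, if_neg (by omega)]
  | succ t ih =>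
    intro d hd
    rcases d with _ | d
    · have h1 := ih 1 (by omega)
      rw [xs_root]; unfold uu hh; omega
    · have h1 := ih d (by omega)
      have h2 := ih (d + 2) (by omega)
      rw [xs_succ]; unfold uu hh; omega

lemma xs_root_even (D t : ℕ) (hD : 1 ≤ D) : xs D t 0 % 2 = 0 := by
  rcases t with _ | t
  · rw [xs_zero, if_pos rfl]
    obtain ⟨k, rfl⟩ : ∃ k, D = k + 1 := ⟨D - 1, by omega⟩
    rw [pow_succ]; omega
  · rw [xs_root]; omega

lemma uu_root (D t : ℕ) (hD : 1 ≤ D) : uu D t 0 = 0 := by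
  have := xs_root_even D t hD
  unfold uu hh fr; simp; omega

lemma xs_sum (D t : ℕ) (hD : 1 ≤ D) : ∀ M, t < M → ∑ d ∈ range M, 2 ^ d * xs D t d = 2 ^ D := by
  induction t with
  | zero =>
    intro M hM
    rw [sum_eq_single 0]
    · simp [xs_zero]
    · intro b _ hb; simp [xs_zero, hb]
    · intro h; simp at h; omega
  | succ t ih =>
    intro M hM
    obtain ⟨M, rfl⟩ : ∃ k, M = k + 1 := ⟨M - 1, by omega⟩
    rw [← ih M (by omega), sum_range_succ', xs_root]
    simp only [xs_succ]
    have h1 : ∑ d ∈ range (M + 2), 2 ^ d * uu D t d = ∑ d ∈ range M, 2 ^ d * uu D t d := by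
      rw [sum_range_succ, sum_range_succ]
      have a := xs_big D t M (by omega)
      have b := xs_big D t (M + 1) (by omega)
      have a' : uu D t M = 0 := by unfold uu; omega
      have b' : uu D t (M + 1) = 0 := by unfold uu; omega
      rw [a', b']; simp
    have h2 : ∑ d ∈ range M, 2 ^ d * xs D t d
        = ∑ d ∈ range M, 2 ^ d * uu D t d + ∑ d ∈ range M, 2 ^ d * (2 * hh D t d) := by
      rw [← sum_add_distrib]; apply sum_congr rfl; intro d _; rw [← uu_add D t d]; ring
    rw [h2, ← h1, sum_range_succ', sum_range_succ', uu_root D t hD]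
    have h3 : ∑ d ∈ range M, 2 ^ (d + 1) * (hh D t d + 2 * uu D t (d + 2))
      = ∑ d ∈ range M, 2 ^ (d + 1 + 1) * uu D t (d + 1 + 1) + ∑ d ∈ range M, 2 ^ d * (2 * hh D t d) := by
      rw [← sum_add_distrib]; apply sum_congr rfl; intro d _; ring
    rw [h3]; ring

noncomputable def cap (D t d : ℕ) : ℝ := 2 ^ D * 16 ^ d / 2 ^ t

lemma cap_pos (D t d : ℕ) : 0 < cap D t d := by unfold cap; positivity
lemma cap_succ (D t d : ℕ) : cap D t (d + 1) = 16 * cap D t d := by unfold cap; rw [pow_succ]; ring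
lemma cap_time (D t d : ℕ) : cap D (t + 1) d = cap D t d / 2 := by unfold cap; rw [pow_succ]; field_simp
lemma cap_add (D t d e : ℕ) : cap D t (d + e) = 16 ^ e * cap D t d := by unfold cap; rw [pow_add]; ring
lemma cap_eq (D t d : ℕ) : cap D t d * 2 ^ t = 2 ^ (D + 4 * d) := by
  unfold cap; rw [pow_add, pow_mul]; norm_num
lemma cap_ge_iff (D t d k : ℕ) : (2:ℝ) ^ k ≤ cap D t d ↔ t + k ≤ D + 4 * d := by
  rw [← mul_le_mul_iff_left₀ (show (0:ℝ) < 2 ^ t by positivity), cap_eq, ← pow_add,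
    pow_le_pow_iff_right₀ (by norm_num), add_comm]

lemma fr_eq (D t d : ℕ) (hd : d ≠ 0) (h : t + 8 ≤ D + 4 * d) : (fr D t d : ℝ) = cap D t d / 256 := by
  have h1 : fr D t d * 2 ^ (t + 8) = 2 ^ (D + 4 * d) := by
    unfold fr; rw [if_neg hd]; exact Nat.div_mul_cancel (pow_dvd_pow 2 h)
  have h2 : (fr D t d : ℝ) * 2 ^ (t + 8) = 2 ^ (D + 4 * d) := by exact_mod_cast h1
  rw [← cap_eq D t d, pow_add, ← mul_assoc, mul_right_comm] at h2
  have : (0:ℝ) < 2 ^ t := by positivity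
  have h3 := mul_right_cancel₀ this.ne' h2
  linarith

lemma fr_zero (D t d : ℕ) (h : ¬ (d ≠ 0 ∧ t + 8 ≤ D + 4 * d)) : fr D t d = 0 := by
  unfold fr
  split_ifs with h0
  · rfl
  · exact Nat.div_eq_of_lt (Nat.pow_lt_pow_right (by norm_num) (by
      by_contra h2; exact h ⟨h0, by omega⟩))

/-- an integer bounded by `cap/256` is bounded by the fringe -/
lemma le_fr (D t d k : ℕ) (hd : d ≠ 0) (h : (k : ℝ) ≤ cap D t d / 256) : k ≤ fr D t d := by
  by_cases h1 : t + 8 ≤ D + 4 * d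
  · have := fr_eq D t d hd h1
    rw [← this] at h; exact_mod_cast h
  · have : ¬ ((2:ℝ)^8 ≤ cap D t d) := by rw [cap_ge_iff]; exact h1
    have h3 : (k : ℝ) < 1 := by norm_num at this; linarith
    have : k < 1 := by exact_mod_cast h3
    omega

lemma xs_le_pow (D t d : ℕ) (hD : 1 ≤ D) : 2 ^ d * xs D t d ≤ 2 ^ D := by
  by_cases hd : t < d
  · rw [xs_big D t d hd]; simp
  rw [← xs_sum D t hD (t + 1) (by omega)]
  exact single_le_sum (f := fun d => 2 ^ d * xs D t d) (fun _ _ => Nat.zero_le _) (mem_range.mpr (by omega))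

lemma xs_deep (D t d : ℕ) (hD : 1 ≤ D) (hd : D < d) : xs D t d = 0 := by
  by_contra h
  have h1 := xs_le_pow D t d hD
  have h2 : 2 ^ D < 2 ^ d := Nat.pow_lt_pow_right (by norm_num) hd
  have h3 : 2 ^ d * 1 ≤ 2 ^ d * xs D t d := Nat.mul_le_mul_left _ (by omega)
  omega

lemma hh_deep (D t d : ℕ) (hD : 1 ≤ D) (hd : D ≤ d) : hh D t d = 0 := by
  have h1 := xs_le_pow D t d hD
  have h2 : 2 ^ D ≤ 2 ^ d := Nat.pow_le_pow_right (by norm_num) hd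
  have h3 : xs D t d ≤ 1 := by
    by_contra h
    have h3 : 2 ^ d * 2 ≤ 2 ^ d * xs D t d := Nat.mul_le_mul_left _ (by omega)
    have : 0 < 2 ^ D := by positivity
    omega
  unfold hh; omega

lemma cap_mono_d (D t : ℕ) {d e : ℕ} (h : d ≤ e) : cap D t d ≤ cap D t e := by
  obtain ⟨k, rfl⟩ := Nat.exists_eq_add_of_le h
  rw [cap_add]
  have := cap_pos D t d
  have h1 : (1:ℝ) ≤ 16 ^ k := one_le_pow₀ (by norm_num)
  nlinarith

lemma xs_even_of (D t : ℕ) (hD : 1 ≤ D) (ht : t + 8 ≤ 5 * D) (hc : ∀ d, (xs D t d : ℝ) ≤ cap D t d)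
    (d : ℕ) (h : D + 4 * d < t + 8 ∨ d = 0) : xs D t d % 2 = 0 := by
  rcases Nat.eq_zero_or_pos d with h0 | h0
  · rw [h0]; exact xs_root_even D t hD
  have h : D + 4 * d < t + 8 := by omega
  by_cases hp : (t + d) % 2 = 1
  · rw [xs_odd D t d hp]
  have hdD : d < D := by omega
  by_cases hdt : t < d
  · rw [xs_big D t d hdt]
  have hsm : ∀ d' < d, xs D t d' = 0 := by
    intro d' hd'
    by_cases h1 : d' = d - 1
    · apply xs_odd; omega
    · have h2 := hc d'
      have h3 : ¬ ((2:ℝ)^0 ≤ cap D t d') := by rw [cap_ge_iff]; omega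
      norm_num at h3
      have : (xs D t d' : ℝ) < 1 := by linarith
      have : xs D t d' < 1 := by exact_mod_cast this
      omega
  have hs := xs_sum D t hD (d + 1 + t) (by omega)
  rw [sum_range_add, sum_range_succ, sum_eq_zero (fun d' hd' => by rw [hsm d' (mem_range.mp hd')]; simp)] at hs
  have h4 : ∑ n ∈ range t, 2 ^ (d + 1 + n) * xs D t (d + 1 + n)
    = 2 ^ d * (2 * ∑ n ∈ range t, 2 ^ n * xs D t (d + 1 + n)) := by
    rw [mul_sum, mul_sum]; apply sum_congr rfl; intro n _; ring
  obtain ⟨k, hk⟩ := Nat.exists_eq_add_of_lt hdD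
  have h6 : 2 ^ D = 2 ^ d * 2 ^ (k + 1) := by rw [hk, add_assoc, pow_add]
  rw [h4, zero_add, ← mul_add, h6] at hs
  have h5 := Nat.eq_of_mul_eq_mul_left (by positivity) hs
  rw [pow_succ] at h5
  omega

lemma two_uu (D t d : ℕ) (hD : 1 ≤ D) (ht : t + 8 ≤ 5 * D) (hc : ∀ d, (xs D t d : ℝ) ≤ cap D t d) :
    (2 * uu D t (d + 1) : ℝ) ≤ 3 * cap D t d / 8 := by
  have hp := cap_pos D t d
  by_cases h : t + 8 ≤ D + 4 * (d + 1)
  · have h1 := fr_eq D t (d + 1) (by omega) h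
    have h2 : (uu D t (d + 1) : ℝ) ≤ 2 * fr D t (d + 1) + 1 := by exact_mod_cast uu_le D t (d + 1)
    rw [h1, cap_succ] at h2
    have h3 : (2:ℝ) ^ 4 ≤ cap D t d := by rw [cap_ge_iff]; omega
    norm_num at h3
    linarith
  · have h1 := fr_zero D t (d + 1) (by tauto)
    have h2 := xs_even_of D t hD ht hc (d + 1) (by omega)
    have : uu D t (d + 1) = 0 := by unfold uu hh; omega
    rw [this]; simp; positivity

lemma xs_cap (D : ℕ) (hD : 1 ≤ D) (t : ℕ) (ht : t + 7 ≤ 5 * D) : ∀ d, (xs D t d : ℝ) ≤ cap D t d := by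
  induction t with
  | zero =>
    intro d
    rw [xs_zero]
    split_ifs with h
    · subst h; simp [cap]
    · simpa using (cap_pos D 0 d).le
  | succ t ih =>
    have ih := ih (by omega)
    intro d
    have h := two_uu D t d hD (by omega) ih
    have hp := cap_pos D t d
    rw [cap_time]
    rcases d with _ | d
    · rw [xs_root]; push_cast; linarith
    · rw [xs_succ]
      have h1 : hh D t d * 2 ≤ xs D t d := by unfold hh; omega
      have h1' : (hh D t d * 2 : ℝ) ≤ xs D t d := by exact_mod_cast h1
      have h2 := ih d
      rw [cap_succ] at *
      push_cast
      linarith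

lemma xs_even (D t : ℕ) (hD : 1 ≤ D) (ht : t + 8 ≤ 5 * D)
    (d : ℕ) (h : D + 4 * d < t + 8 ∨ d = 0) : xs D t d % 2 = 0 :=
  xs_even_of D t hD ht (xs_cap D hD t (by omega)) d h

lemma xs_fr (D t d : ℕ) (hD : 1 ≤ D) (ht : t + 7 ≤ 5 * D) :
    fr D t d = 0 ∨ xs D t d ≤ 256 * fr D t d := by
  by_cases h : d ≠ 0 ∧ t + 8 ≤ D + 4 * d
  · right
    have h1 := fr_eq D t d h.1 h.2
    have h2 := xs_cap D hD t ht d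
    have : (xs D t d : ℝ) ≤ 256 * fr D t d := by rw [h1]; linarith
    exact_mod_cast this
  · left; exact fr_zero D t d h

lemma above_cap (D t d : ℕ) : ∑ e ∈ range d, 2 ^ e * cap D t e ≤ 2 ^ d * cap D t d / 31 := by
  induction d with
  | zero => have := cap_pos D t 0; simp; positivity
  | succ d ih =>
    rw [sum_range_succ, cap_succ, pow_succ]
    nlinarith

lemma above (D t d : ℕ) (hD : 1 ≤ D) (ht : t + 7 ≤ 5 * D) (hx : (t + d) % 2 = 0) :
    (∑ e ∈ range d, 2 ^ e * xs D t e : ℝ) ≤ 2 ^ d * cap D t d / 992 := by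
  rcases d with _ | d
  · have := cap_pos D t 0; simp; positivity
  · rw [sum_range_succ, xs_odd D t d (by omega)]
    have h1 : (∑ e ∈ range d, 2 ^ e * xs D t e : ℝ) ≤ ∑ e ∈ range d, 2 ^ e * cap D t e :=
      sum_le_sum fun e _ => mul_le_mul_of_nonneg_left (xs_cap D hD t ht e) (by positivity)
    have h2 := above_cap D t d
    rw [cap_succ, pow_succ]
    push_cast
    nlinarith

end AKS

namespace AKS

lemma final_sizes (D t d : ℕ) (hD : 2 ≤ D) (ht : t + 7 = 5 * D) :
    xs D t d = if d = D - 1 then 2 else 0 := by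
  have key : ∀ e, e ≠ D - 1 → xs D t e = 0 := by
    intro e he
    by_cases h1 : D < e
    · exact xs_deep D t e (by omega) h1
    by_cases h2 : e = D
    · apply xs_odd; omega
    · have h2 := xs_cap D (by omega) t (by omega) e
      have h3 : ¬ ((2:ℝ)^0 ≤ cap D t e) := by rw [cap_ge_iff]; omega
      norm_num at h3
      have : (xs D t e : ℝ) < 1 := by linarith
      have : xs D t e < 1 := by exact_mod_cast this
      omega
  split_ifs with h
  · subst h
    have hs := xs_sum D t (by omega) (D + t) (by omega)
    rw [sum_eq_single (D - 1)] at hs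
    · obtain ⟨k, rfl⟩ : ∃ k, D = k + 1 := ⟨D - 1, by omega⟩
      rw [pow_succ] at hs
      simp only [Nat.add_sub_cancel] at hs ⊢
      exact Nat.eq_of_mul_eq_mul_left (by positivity) hs
    · intro e _ he; rw [key e he]; simp
    · intro h; simp at h; omega
  · exact key d h

lemma fibre_equiv {W C : Type} [Fintype W] [DecidableEq C] (loc : W → C) (x : C → ℕ)
    (hc : ∀ c, (univ.filter fun w => loc w = c).card = x c) :
    ∃ e : W ≃ Σ c, Fin (x c), ∀ w, (e w).1 = loc w := by
  have h : ∀ c, Fintype.card {w // loc w = c} = x c := fun c => by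
    rw [Fintype.card_subtype]; exact hc c
  refine ⟨(Equiv.sigmaFiberEquiv loc).symm.trans
    (Equiv.sigmaCongrRight fun c => Fintype.equivFinOfCardEq (h c)), fun w => rfl⟩

lemma bag_step (q : ℕ) {W C : Type} [Fintype W] [DecidableEq C] (loc : W → C) (x f : C → ℕ)
    (hq : ∀ c, 2 * f c ≤ x c →
      ∃ L : List (CS (Fin (x c))), L.length = q ∧
      (∀ y, cnt false y ≤ f c → 256 * leakLo (f c) (run L y) ≤ cnt false y) ∧
      (∀ y, cnt true y ≤ f c → 256 * leakHi (x c - f c) (run L y) ≤ cnt true y) ∧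
      (∀ y, 256 * leakLo (x c / 2) (run L y) ≤ 256 * (cnt false y - x c / 2) + x c / 2) ∧
      (∀ y, 256 * leakHi (x c - x c / 2) (run L y) ≤ 256 * (cnt true y - x c / 2) + x c / 2))
    (hc : ∀ c, (univ.filter fun w => loc w = c).card = x c) :
    ∃ M : List (CS W), M.length = q ∧ ∃ pos : W → ℕ,
      (∀ c a b, b ≤ x c → (univ.filter fun w => loc w = c ∧ a ≤ pos w ∧ pos w < b).card = b - a) ∧
      (∀ g : W → ℕ, ∀ c,
        (∀ (P : ℕ → Prop) [DecidablePred P], (univ.filter fun w => loc w = c ∧ P (run M g w)).card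
          = (univ.filter fun w => loc w = c ∧ P (g w)).card) ∧
        (2 * f c ≤ x c → ∀ v,
          ((univ.filter fun w => loc w = c ∧ g w < v).card ≤ f c →
            256 * (univ.filter fun w => loc w = c ∧ f c ≤ pos w ∧ run M g w < v).card
              ≤ (univ.filter fun w => loc w = c ∧ g w < v).card) ∧
          ((univ.filter fun w => loc w = c ∧ v ≤ g w).card ≤ f c →
            256 * (univ.filter fun w => loc w = c ∧ pos w < x c - f c ∧ v ≤ run M g w).card
              ≤ (univ.filter fun w => loc w = c ∧ v ≤ g w).card) ∧
          (256 * (univ.filter fun w => loc w = c ∧ x c / 2 ≤ pos w ∧ run M g w < v).card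
            ≤ 256 * ((univ.filter fun w => loc w = c ∧ g w < v).card - x c / 2) + x c / 2) ∧
          (256 * (univ.filter fun w => loc w = c ∧ pos w < x c - x c / 2 ∧ v ≤ run M g w).card
            ≤ 256 * ((univ.filter fun w => loc w = c ∧ v ≤ g w).card - x c / 2) + x c / 2))) := by
  classical
  obtain ⟨e, he⟩ := fibre_equiv loc x hc
  have hL : ∀ c, ∃ L : List (CS (Fin (x c))), L.length = q ∧ (2 * f c ≤ x c →
      (∀ y, cnt false y ≤ f c → 256 * leakLo (f c) (run L y) ≤ cnt false y) ∧
      (∀ y, cnt true y ≤ f c → 256 * leakHi (x c - f c) (run L y) ≤ cnt true y) ∧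
      (∀ y, 256 * leakLo (x c / 2) (run L y) ≤ 256 * (cnt false y - x c / 2) + x c / 2) ∧
      (∀ y, 256 * leakHi (x c - x c / 2) (run L y) ≤ 256 * (cnt true y - x c / 2) + x c / 2)) := by
    intro c
    by_cases h : 2 * f c ≤ x c
    · obtain ⟨L, h1, h2⟩ := hq c h
      exact ⟨L, h1, fun _ => h2⟩
    · exact ⟨List.replicate q (idle _), by simp, fun h' => absurd h' h⟩
  choose L hlen hL using hL
  obtain ⟨M, hM, hrun⟩ := sig_run q L hlen
  have bridge : ∀ (R : W → Prop) [DecidablePred R] (c : C),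
      (univ.filter fun w => loc w = c ∧ R w).card = (univ.filter fun p : Fin (x c) => R (e.symm ⟨c, p⟩)).card := by
    intro R _ c
    symm
    refine card_bij (fun p _ => e.symm ⟨c, p⟩) ?_ ?_ ?_
    · intro p hp
      rw [mem_filter] at hp ⊢
      refine ⟨mem_univ _, ?_, hp.2⟩
      rw [← he]; simp
    · intro p _ p' _ h
      have := e.symm.injective h
      simpa using this
    · intro w hw
      rw [mem_filter] at hw
      obtain ⟨_, rfl, h2⟩ := hw
      have h3 : e.symm ⟨loc w, (he w) ▸ (e w).2⟩ = w := by
        rw [Equiv.symm_apply_eq]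
        rw [Sigma.ext_iff]
        refine ⟨(he w).symm, ?_⟩
        simp
      refine ⟨(he w) ▸ (e w).2, ?_, h3⟩
      rw [mem_filter, h3]; exact ⟨mem_univ _, h2⟩
  have hr : ∀ {α : Type} [LinearOrder α] (g : W → α) (c : C) (p : Fin (x c)),
      run (M.map (embed e.symm.toEmbedding)) g (e.symm ⟨c, p⟩) = run (L c) (fun p => g (e.symm ⟨c, p⟩)) p := by
    intro α _ g c p
    have h1 := congrFun (embed_run e.symm.toEmbedding M g) ⟨c, p⟩
    have h2 := congrFun (hrun (fun z => g (e.symm z)) c) p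
    exact h1.trans h2
  have hps : ∀ c p, (e (e.symm ⟨c, p⟩)).2.1 = p.1 := fun c p =>
    congrArg (fun z : Σ c, Fin (x c) => z.2.1) (e.apply_symm_apply ⟨c, p⟩)
  refine ⟨M.map (embed e.symm.toEmbedding), by simp [hM], fun w => (e w).2.1, ?_, ?_⟩
  · intro c a b hb
    rw [bridge (fun w => a ≤ ((e w).2).1 ∧ ((e w).2).1 < b)]
    simp only [hps]
    rw [← Nat.card_Ico]
    refine card_bij (fun p _ => p.1) ?_ ?_ ?_
    · intro p hp; simpa using hp
    · intro p _ p' _ h; exact Fin.ext h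
    · intro k hk
      rw [mem_Ico] at hk
      exact ⟨⟨k, by omega⟩, by simpa using hk, rfl⟩
  · intro g c
    constructor
    · intro P _
      rw [bridge (fun w => P (run _ g w)), bridge (fun w => P (g w))]
      simp only [hr]
      exact run_count (L c) _ P
    · intro hx v
      obtain ⟨h1, h2, h3, h4⟩ := hL c hx
      set y : Fin (x c) → Bool := fun p => decide (v ≤ g (e.symm ⟨c, p⟩)) with hy
      have hmono : Monotone (fun k : ℕ => decide (v ≤ k)) := by
        intro a b hab
        by_cases h : v ≤ a
        · have : v ≤ b := h.trans hab
          simp [h, this]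
        · simp [h]
      have hyr : ∀ p, run (L c) y p = decide (v ≤ run (L c) (fun p => g (e.symm ⟨c, p⟩)) p) := by
        intro p
        exact congrFun (run_comp (L c) (fun p => g (e.symm ⟨c, p⟩)) hmono) p
      have e1 : (univ.filter fun w => loc w = c ∧ g w < v).card = cnt false y := by
        rw [bridge]; unfold cnt; simp [hy]
      have e2 : (univ.filter fun w => loc w = c ∧ v ≤ g w).card = cnt true y := by
        rw [bridge]; unfold cnt; simp [hy]
      have e3 : ∀ k, (univ.filter fun w => loc w = c ∧ k ≤ (e w).2.1 ∧
          run (M.map (embed e.symm.toEmbedding)) g w < v).card = leakLo k (run (L c) y) := by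
        intro k
        rw [bridge (fun w => k ≤ (e w).2.1 ∧ run (M.map (embed e.symm.toEmbedding)) g w < v)]
        unfold leakLo
        simp only [hr, hyr, hps]; simp
      have e4 : ∀ k, (univ.filter fun w => loc w = c ∧ (e w).2.1 < k ∧
          v ≤ run (M.map (embed e.symm.toEmbedding)) g w).card = leakHi k (run (L c) y) := by
        intro k
        rw [bridge (fun w => (e w).2.1 < k ∧ v ≤ run (M.map (embed e.symm.toEmbedding)) g w)]
        unfold leakHi
        simp only [hr, hyr, hps]; simp
      rw [e1, e2, e3, e4, e3, e4]
      exact ⟨h1 y, h2 y, h3 y, h4 y⟩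

end AKS

namespace AKS

open Classical in
/-- number of elements satisfying a predicate -/
noncomputable def nc {W : Type} [Fintype W] (P : W → Prop) : ℕ := (univ.filter P).card

section nc
variable {W : Type} [Fintype W]

lemma nc_eq (P : W → Prop) [DecidablePred P] : (univ.filter P).card = nc P := by
  unfold nc; congr

lemma nc_mono {P Q : W → Prop} (h : ∀ w, P w → Q w) : nc P ≤ nc Q := by
  classical
  unfold nc
  exact card_le_card (fun w hw => by simp only [mem_filter, mem_univ, true_and] at *; exact h w hw)

lemma nc_congr {P Q : W → Prop} (h : ∀ w, P w ↔ Q w) : nc P = nc Q :=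
  le_antisymm (nc_mono fun w => (h w).1) (nc_mono fun w => (h w).2)

lemma nc_or_le (P Q : W → Prop) : nc (fun w => P w ∨ Q w) ≤ nc P + nc Q := by
  classical
  rw [← nc_eq, ← nc_eq P, ← nc_eq Q, filter_or]
  exact card_union_le _ _

lemma nc_or (P Q : W → Prop) (h : ∀ w, P w → ¬ Q w) : nc (fun w => P w ∨ Q w) = nc P + nc Q := by
  classical
  rw [← nc_eq, ← nc_eq P, ← nc_eq Q, filter_or, card_union_of_disjoint]
  rw [disjoint_filter]
  intro w _ h1; exact h w h1

lemma nc_zero {P : W → Prop} (h : ∀ w, ¬ P w) : nc P = 0 := by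
  classical
  unfold nc
  rw [card_eq_zero, filter_eq_empty_iff]
  intro w _; exact h w

lemma nc_none {P : W → Prop} (h : nc P = 0) (w : W) : ¬ P w := by
  classical
  unfold nc at h
  rw [card_eq_zero, filter_eq_empty_iff] at h
  exact h (mem_univ w)

lemma nc_split (P Q : W → Prop) : nc (fun w => P w ∧ Q w) + nc (fun w => P w ∧ ¬ Q w) = nc P := by
  rw [← nc_or]
  · apply nc_congr; intro w; tauto
  · tauto

end nc

lemma div_ne_iff (g K A : ℕ) (hK : 0 < K) : g / K ≠ A ↔ g < A * K ∨ (A + 1) * K ≤ g := by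
  rw [← Nat.div_lt_iff_lt_mul hK, ← Nat.le_div_iff_mul_le hK]
  omega

def XX (D t : ℕ) (c : ℕ × ℕ) : ℕ := if c.2 < 2 ^ c.1 then xs D t c.1 else 0

def nl (D t : ℕ) (c : ℕ × ℕ) (p : ℕ) : ℕ × ℕ :=
  if fr D t c.1 ≤ p ∧ p < fr D t c.1 + hh D t c.1 then (c.1 + 1, 2 * c.2)
  else if fr D t c.1 + hh D t c.1 ≤ p ∧ p < fr D t c.1 + 2 * hh D t c.1 then (c.1 + 1, 2 * c.2 + 1)
  else (c.1 - 1, c.2 / 2)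

def Up (D t d p : ℕ) : Prop := ¬ (fr D t d ≤ p ∧ p < fr D t d + 2 * hh D t d)
def Pt (D t d a p : ℕ) : Prop :=
  fr D t d + (a % 2) * hh D t d ≤ p ∧ p < fr D t d + (a % 2) * hh D t d + hh D t d

lemma nl_succ (D t : ℕ) (c : ℕ × ℕ) (p d a : ℕ) : nl D t c p = (d + 1, a) ↔
    (c = (d, a / 2) ∧ Pt D t d a p) ∨ (c = (d + 2, 2 * a) ∧ Up D t (d + 2) p) ∨
    (c = (d + 2, 2 * a + 1) ∧ Up D t (d + 2) p) := by
  obtain ⟨d0, i0⟩ := c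
  unfold nl Pt Up
  simp only [Prod.mk.injEq]
  by_cases h0 : d0 = d
  · subst h0
    rcases Nat.mod_two_eq_zero_or_one a with h | h <;> rw [h] <;> split_ifs <;>
      simp only [Prod.mk.injEq, zero_mul, one_mul, true_and] <;> omega
  by_cases h1 : d0 = d + 2
  · subst h1
    split_ifs <;> simp only [Prod.mk.injEq, true_and] <;> omega
  · split_ifs <;> simp only [Prod.mk.injEq, true_and] <;> omega

lemma nl_root (D t : ℕ) (c : ℕ × ℕ) (p a : ℕ) : nl D t c p = (0, a) ↔
    (c = (1, 2 * a) ∧ Up D t 1 p) ∨ (c = (1, 2 * a + 1) ∧ Up D t 1 p) ∨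
    ((c = (0, 2 * a) ∨ c = (0, 2 * a + 1)) ∧ Up D t 0 p) := by
  obtain ⟨d0, i0⟩ := c
  unfold nl Up
  simp only [Prod.mk.injEq]
  by_cases h0 : d0 = 0
  · subst h0
    split_ifs <;> simp <;> omega
  by_cases h1 : d0 = 1
  · subst h1
    split_ifs <;> simp <;> omega
  · split_ifs <;> simp <;> omega

section step
variable {W : Type} [Fintype W] (D t : ℕ) (loc : W → ℕ × ℕ) (pos : W → ℕ)

lemma pt_card (hpos : ∀ c a b, b ≤ XX D t c → nc (fun w => loc w = c ∧ a ≤ pos w ∧ pos w < b) = b - a)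
    (d a i : ℕ) (hi : i < 2 ^ d) :
    nc (fun w => loc w = (d, i) ∧ Pt D t d a (pos w)) = hh D t d := by
  rcases Nat.eq_zero_or_pos (hh D t d) with h | h
  · rw [h]; apply nc_zero; unfold Pt; rw [h]; intro w; omega
  · unfold Pt
    rw [hpos]
    · omega
    · unfold XX; rw [if_pos hi]; unfold hh at *
      simp only
      rcases Nat.mod_two_eq_zero_or_one a with h' | h' <;> rw [h'] <;> omega

lemma up_card (hc : ∀ c, nc (fun w => loc w = c) = XX D t c)
    (hpos : ∀ c a b, b ≤ XX D t c → nc (fun w => loc w = c ∧ a ≤ pos w ∧ pos w < b) = b - a)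
    (d i : ℕ) (hi : i < 2 ^ d) :
    nc (fun w => loc w = (d, i) ∧ Up D t d (pos w)) = uu D t d := by
  have h1 := nc_split (fun w => loc w = (d, i)) (fun w => fr D t d ≤ pos w ∧ pos w < fr D t d + 2 * hh D t d)
  rw [hc] at h1
  have h2 : nc (fun w => loc w = (d, i) ∧ fr D t d ≤ pos w ∧ pos w < fr D t d + 2 * hh D t d) = 2 * hh D t d := by
    rcases Nat.eq_zero_or_pos (hh D t d) with h | h
    · rw [h]; apply nc_zero; intro w; omega
    · rw [hpos]
      · omega
      · unfold XX; rw [if_pos hi]; unfold hh at *; simp only; omega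
  rw [h2] at h1
  unfold XX at h1
  rw [if_pos hi] at h1
  unfold Up uu
  simp only at h1
  omega

lemma none_card (hc : ∀ c, nc (fun w => loc w = c) = XX D t c)
    (d i : ℕ) (h : ¬ i < 2 ^ d ∨ xs D t d = 0) (w : W) : loc w ≠ (d, i) := by
  intro hw
  have h1 := hc (d, i)
  have : XX D t (d, i) = 0 := by
    unfold XX
    split_ifs with h2
    · rcases h with h | h
      · exact absurd h2 h
      · exact h
    · rfl
  rw [this] at h1
  exact nc_none h1 w hw

lemma nl_card (hD : 1 ≤ D) (hc : ∀ c, nc (fun w => loc w = c) = XX D t c)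
    (hpos : ∀ c a b, b ≤ XX D t c → nc (fun w => loc w = c ∧ a ≤ pos w ∧ pos w < b) = b - a) :
    ∀ c, nc (fun w => nl D t (loc w) (pos w) = c) = XX D (t + 1) c := by
  rintro ⟨d, a⟩
  have hno := none_card D t loc hc
  rcases d with _ | d
  · simp only [nl_root]
    by_cases ha : a < 2 ^ 0
    · have ha0 : a = 0 := by simpa using ha
      subst ha0
      rw [nc_or, nc_or, up_card D t loc pos hc hpos 1 _ (by norm_num), up_card D t loc pos hc hpos 1 _ (by norm_num)]
      · have h3 : nc (fun w => (loc w = (0, 2 * 0) ∨ loc w = (0, 2 * 0 + 1)) ∧ Up D t 0 (pos w)) ≤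
          nc (fun w => loc w = (0, 0) ∧ Up D t 0 (pos w)) := by
          apply nc_mono
          intro w hw
          refine ⟨hw.1.resolve_right (hno _ _ (by left; norm_num) w), hw.2⟩
        rw [up_card D t loc pos hc hpos 0 _ (by norm_num), uu_root D t hD] at h3
        unfold XX
        rw [if_pos ha]
        simp only
        rw [xs_root]
        omega
      · intro w h1 h2
        rcases h2.1 with h | h <;> · have := h1.1.symm.trans h; simp at this
      · intro w h1 h2
        rcases h2 with h2 | ⟨h | h, _⟩
        · have := h1.1.symm.trans h2.1; simp at this
        all_goals have := h1.1.symm.trans h; simp at this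
    · unfold XX
      rw [if_neg ha]
      have ha' : a ≠ 0 := by simpa using ha
      apply nc_zero
      rintro w (⟨h, _⟩ | ⟨h, _⟩ | ⟨h | h, _⟩) <;> exact hno _ _ (by left; first | omega | (norm_num; done) | (norm_num; omega)) w h
  · simp only [nl_succ]
    have hp : 2 ^ (d + 1) = 2 * 2 ^ d := by ring
    have hp2 : 2 ^ (d + 2) = 4 * 2 ^ d := by ring
    by_cases ha : a < 2 ^ (d + 1)
    · rw [nc_or, nc_or, pt_card D t loc pos hpos d a _ (by omega), up_card D t loc pos hc hpos _ _ (by omega),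
        up_card D t loc pos hc hpos _ _ (by omega)]
      · unfold XX
        rw [if_pos ha]
        simp only
        rw [xs_succ]
        omega
      · intro w h1 h2
        have := h1.1.symm.trans h2.1; simp at this
      · intro w h1 h2
        rcases h2 with h2 | h2 <;> · have := h1.1.symm.trans h2.1; simp at this
    · unfold XX
      rw [if_neg ha]
      apply nc_zero
      rintro w (⟨h, _⟩ | ⟨h, _⟩ | ⟨h, _⟩) <;> exact hno _ _ (by left; omega) w h

end step

end AKS

namespace AKS

def Inv {W : Type} [Fintype W] (D t : ℕ) (loc : W → ℕ × ℕ) (g : W → ℕ) : Prop :=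
  ∀ d i j, d ≤ D → i < 2 ^ d →
    (nc (fun w => loc w = (d, i) ∧ g w / 2 ^ (D - d + j) ≠ i / 2 ^ j) : ℝ) ≤ cap D t d / 256 ^ (j + 1)

lemma geo (M : ℕ) (b : ℝ) : ∑ e ∈ range (M + 1), 2 ^ e * (if e = 0 then 0 else b / 16 ^ (e + 1))
    = b / 112 * (1 - (1 / 8) ^ M) := by
  induction M with
  | zero => simp
  | succ M ih =>
    rw [sum_range_succ, ih, if_neg (by omega)]
    have h16 : (16:ℝ) ^ (M + 1 + 1) = 8 ^ (M + 1) * 2 ^ (M + 1) * 16 := by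
      rw [pow_succ, ← mul_pow]; norm_num
    rw [h16, div_pow, div_pow, one_pow, one_pow, pow_succ (8:ℝ)]
    have h8 : (8:ℝ) ^ M ≠ 0 := by positivity
    field_simp
    ring

section
variable {W : Type} [Fintype W] (D t : ℕ) (loc : W → ℕ × ℕ) (g : W → ℕ)

lemma balance (hD : 1 ≤ D) (ht : t + 7 ≤ 5 * D) (hc : ∀ c, nc (fun w => loc w = c) = XX D t c)
    (hI : Inv D t loc g)
    (hg : ∀ k a, k ≤ D → a < 2 ^ (D - k) → nc (fun w => g w / 2 ^ k = a) = 2 ^ k)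
    (d a : ℕ) (hd : d < D) (ha : a < 2 ^ (d + 1)) (hpar : (t + d) % 2 = 0) :
    (nc (fun w => loc w = (d, a / 2) ∧ g w / 2 ^ (D - d - 1) = a) : ℝ)
      ≤ xs D t d / 2 + cap D t d / 1984 + cap D t d / 112 := by
  classical
  set N := nc (fun w => loc w = (d, a / 2) ∧ g w / 2 ^ (D - d - 1) = a) with hN
  set na : ℕ → ℕ → ℕ := fun e r => nc (fun w => loc w = (d + 1 + e, a * 2 ^ e + r) ∧ g w / 2 ^ (D - d - 1) = a) with hna
  -- disjoint union
  have h1 : N + ∑ e ∈ range (t + 1), ∑ r ∈ range (2 ^ e), na e r ≤ 2 ^ (D - d - 1) := by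
    rw [← hg (D - d - 1) a (by omega) (by
      have : D - (D - d - 1) = d + 1 := by omega
      rw [this]; exact ha)]
    rw [← sum_sigma (range (t + 1)) (fun e => range (2 ^ e)) (fun z => na z.1 z.2)]
    have h2 : ∑ z ∈ (range (t + 1)).sigma (fun e => range (2 ^ e)), na z.1 z.2
      = (((range (t + 1)).sigma (fun e => range (2 ^ e))).biUnion (fun z => univ.filter fun w =>
          loc w = (d + 1 + z.1, a * 2 ^ z.1 + z.2) ∧ g w / 2 ^ (D - d - 1) = a)).card := by
      rw [card_biUnion]
      · apply sum_congr rfl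
        intro z _
        simp only [hna, nc_eq]
      · rintro ⟨e, r⟩ _ ⟨e', r'⟩ _ hne
        change Disjoint _ _
        rw [disjoint_filter]
        intro w _ hw hw'
        apply hne
        have := hw.1.symm.trans hw'.1
        simp only [Prod.mk.injEq] at this
        obtain ⟨h3, h4⟩ := this
        have h5 : e = e' := by omega
        subst h5
        have h6 : r = r' := by omega
        rw [h6]
    rw [h2, hN, ← nc_eq, ← nc_eq, ← card_union_of_disjoint]
    · apply card_le_card
      intro w hw
      rw [mem_union, mem_biUnion] at hw
      rcases hw with hw | ⟨z, _, hw⟩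
      · exact mem_filter.mpr ⟨mem_univ _, (mem_filter.mp hw).2.2⟩
      · exact mem_filter.mpr ⟨mem_univ _, (mem_filter.mp hw).2.2⟩
    · rw [disjoint_left]
      intro w hw hw'
      rw [mem_biUnion] at hw'
      obtain ⟨z, _, hw'⟩ := hw'
      have h3 := (mem_filter.mp hw).2.1
      have h4 := (mem_filter.mp hw').2.1
      have := h3.symm.trans h4
      simp only [Prod.mk.injEq] at this
      omega
  -- per bag
  have h2 : ∀ e, ∀ r ∈ range (2 ^ e), (xs D t (d + 1 + e) : ℝ) - (if e = 0 then 0 else cap D t d / 16 ^ (e + 1)) ≤ na e r := by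
    intro e r hr
    rw [mem_range] at hr
    have hcp := cap_pos D t d
    rcases Nat.eq_zero_or_pos e with he | he
    · rw [if_pos he, he, xs_odd D t (d + 1 + 0) (by omega)]; simp
    rw [if_neg (by omega)]
    by_cases hde : d + 1 + e ≤ D
    · have hlt : a * 2 ^ e + r < 2 ^ (d + 1 + e) := by
        rw [pow_add 2 (d + 1) e]
        calc a * 2 ^ e + r < a * 2 ^ e + 2 ^ e := by omega
          _ = (a + 1) * 2 ^ e := by ring
          _ ≤ _ := Nat.mul_le_mul_right _ ha
      have h3 := hI (d + 1 + e) (a * 2 ^ e + r) e hde hlt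
      have h4 : (a * 2 ^ e + r) / 2 ^ e = a := by
        rw [mul_comm, Nat.mul_add_div (by positivity), Nat.div_eq_of_lt hr, add_zero]
      have h5 : D - (d + 1 + e) + e = D - d - 1 := by omega
      rw [h4, h5] at h3
      have h6 := nc_split (fun w => loc w = (d + 1 + e, a * 2 ^ e + r)) (fun w => g w / 2 ^ (D - d - 1) = a)
      rw [hc] at h6
      have h7 : XX D t (d + 1 + e, a * 2 ^ e + r) = xs D t (d + 1 + e) := by
        unfold XX; rw [if_pos hlt]
      rw [h7] at h6
      have h6' : (na e r : ℝ) + nc (fun w => loc w = (d + 1 + e, a * 2 ^ e + r) ∧ ¬ g w / 2 ^ (D - d - 1) = a) = xs D t (d + 1 + e) := by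
        exact_mod_cast h6
      have h8 : cap D t (d + 1 + e) / 256 ^ (e + 1) = cap D t d / 16 ^ (e + 1) := by
        rw [add_assoc, add_comm 1 e, cap_add]
        have : (256:ℝ) ^ (e + 1) = 16 ^ (e + 1) * 16 ^ (e + 1) := by rw [← mul_pow]; norm_num
        rw [this]; field_simp
      rw [h8] at h3
      linarith
    · rw [xs_deep D t _ hD (by omega)]
      have : 0 ≤ cap D t d / 16 ^ (e + 1) := by positivity
      have : (0:ℝ) ≤ na e r := by positivity
      push_cast
      linarith
  have h3 : ∑ e ∈ range (t + 1), (2:ℝ) ^ e * ((xs D t (d + 1 + e) : ℝ) - (if e = 0 then 0 else cap D t d / 16 ^ (e + 1)))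
      ≤ ∑ e ∈ range (t + 1), ∑ r ∈ range (2 ^ e), (na e r : ℝ) := by
    apply sum_le_sum
    intro e _
    have := card_nsmul_le_sum (range (2 ^ e)) (fun r => (na e r : ℝ)) _ (h2 e)
    rw [card_range, nsmul_eq_mul] at this
    exact_mod_cast this
  have h1' : (N : ℝ) + ∑ e ∈ range (t + 1), ∑ r ∈ range (2 ^ e), (na e r : ℝ) ≤ 2 ^ (D - d - 1) := by
    exact_mod_cast h1
  simp only [mul_sub, sum_sub_distrib] at h3
  rw [geo] at h3
  have h4 := xs_sum D t hD (d + 1 + (t + 1)) (by omega)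
  rw [sum_range_add, sum_range_succ] at h4
  have h4' : (∑ e ∈ range d, 2 ^ e * xs D t e : ℝ) + 2 ^ d * xs D t d
      + ∑ e ∈ range (t + 1), 2 ^ (d + 1 + e) * (xs D t (d + 1 + e) : ℝ) = 2 ^ D := by
    exact_mod_cast h4
  have h5 : ∑ e ∈ range (t + 1), 2 ^ (d + 1 + e) * (xs D t (d + 1 + e) : ℝ)
      = 2 ^ (d + 1) * ∑ e ∈ range (t + 1), 2 ^ e * (xs D t (d + 1 + e) : ℝ) := by
    rw [mul_sum]; apply sum_congr rfl; intro e _; rw [pow_add]; ring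
  have h6 := above D t d hD ht hpar
  rw [h5] at h4'
  set S := ∑ e ∈ range (t + 1), (2:ℝ) ^ e * (xs D t (d + 1 + e) : ℝ)
  set A := (∑ e ∈ range d, 2 ^ e * xs D t e : ℝ)
  have h7 : (2:ℝ) ^ D = 2 ^ (d + 1) * 2 ^ (D - d - 1) := by rw [← pow_add]; congr 1; omega
  have h8 : (0:ℝ) < 2 ^ d := by positivity
  rw [h7, pow_succ] at h4'
  have h9 : (2:ℝ) ^ (D - d - 1) - S ≤ xs D t d / 2 + cap D t d / 1984 := by
    have : 2 ^ d * ((2:ℝ) ^ (D - d - 1) - S) ≤ 2 ^ d * (xs D t d / 2 + cap D t d / 1984) := by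
      nlinarith
    exact le_of_mul_le_mul_left this h8
  have h10 : cap D t d / 112 * (1 - (1 / 8) ^ t) ≤ cap D t d / 112 := by
    have := cap_pos D t d
    have : (0:ℝ) ≤ (1 / 8) ^ t := by positivity
    nlinarith
  linarith

end

end AKS

namespace AKS

section
variable {W : Type} [Fintype W] (D t : ℕ) (loc : W → ℕ × ℕ) (pos : W → ℕ) (g g' : W → ℕ)

lemma str_split (c : ℕ × ℕ) (g : W → ℕ) (K A : ℕ) (hK : 0 < K) :
    nc (fun w => loc w = c ∧ g w / K ≠ A) =
      nc (fun w => loc w = c ∧ g w < A * K) + nc (fun w => loc w = c ∧ (A + 1) * K ≤ g w) := by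
  rw [← nc_or]
  · apply nc_congr; intro w; rw [div_ne_iff _ _ _ hK]; tauto
  · intro w h1 h2
    have : A * K ≤ (A + 1) * K := Nat.mul_le_mul_right _ (by omega)
    omega

/-- the properties provided by the separators in every bag -/
def Sep : Prop :=
  (∀ c (P : ℕ → Prop), nc (fun w => loc w = c ∧ P (g' w)) = nc (fun w => loc w = c ∧ P (g w))) ∧
  ∀ c : ℕ × ℕ, 2 * fr D t c.1 ≤ XX D t c → ∀ v,
          (nc (fun w => loc w = c ∧ g w < v) ≤ fr D t c.1 →
            256 * nc (fun w => loc w = c ∧ fr D t c.1 ≤ pos w ∧ g' w < v)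
              ≤ nc (fun w => loc w = c ∧ g w < v)) ∧
          (nc (fun w => loc w = c ∧ v ≤ g w) ≤ fr D t c.1 →
            256 * nc (fun w => loc w = c ∧ pos w < XX D t c - fr D t c.1 ∧ v ≤ g' w)
              ≤ nc (fun w => loc w = c ∧ v ≤ g w)) ∧
          (256 * nc (fun w => loc w = c ∧ XX D t c / 2 ≤ pos w ∧ g' w < v)
            ≤ 256 * (nc (fun w => loc w = c ∧ g w < v) - XX D t c / 2) + XX D t c / 2) ∧
          (256 * nc (fun w => loc w = c ∧ pos w < XX D t c - XX D t c / 2 ∧ v ≤ g' w)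
            ≤ 256 * (nc (fun w => loc w = c ∧ v ≤ g w) - XX D t c / 2) + XX D t c / 2)

variable {D t loc pos g g'}

lemma part_far (hS : Sep D t loc pos g g') (hI : Inv D t loc g) (hlt : ∀ w, g w < 2 ^ D)
    (d i a j : ℕ) (hd : d ≤ D) (hi : i < 2 ^ d) :
    (nc (fun w => loc w = (d, i) ∧ Pt D t d a (pos w) ∧ g' w / 2 ^ (D - d + j) ≠ i / 2 ^ j) : ℝ)
      ≤ cap D t d / 256 ^ (j + 2) := by
  have hcp := cap_pos D t d
  rcases Nat.eq_zero_or_pos (hh D t d) with h | h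
  · rw [nc_zero]
    · simp; positivity
    · unfold Pt; rw [h]; intro w; omega
  have hX : XX D t (d, i) = xs D t d := by unfold XX; rw [if_pos hi]
  have h2f : 2 * fr D t d ≤ XX D t (d, i) := by rw [hX]; unfold hh at h; omega
  set K := 2 ^ (D - d + j) with hK
  set A := i / 2 ^ j with hA
  have hK0 : 0 < K := by positivity
  have hs := str_split loc (d, i) g K A hK0
  have hb := hI d i j hd hi
  rw [← hK, ← hA] at hb
  set lo := nc (fun w => loc w = (d, i) ∧ g w < A * K)
  set hi' := nc (fun w => loc w = (d, i) ∧ (A + 1) * K ≤ g w)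
  have hfr : lo + hi' ≤ fr D t d := by
    rw [← hs]
    by_cases hd0 : d = 0
    · rw [nc_zero]
      · omega
      · rintro w ⟨_, h2⟩
        apply h2
        subst hd0
        have : i = 0 := by simpa using hi
        subst this
        rw [hA, Nat.zero_div]
        apply Nat.div_eq_of_lt
        refine (hlt w).trans_le ?_
        rw [hK]; exact Nat.pow_le_pow_right (by norm_num) (by omega)
    · apply le_fr _ _ _ _ hd0
      refine hb.trans ?_
      apply div_le_div_of_nonneg_left hcp.le (by norm_num)
      exact le_self_pow₀ (by norm_num) (by omega)
  have h1 := (hS.2 (d, i) h2f (A * K)).1 (by simp only; omega)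
  have h2 := (hS.2 (d, i) h2f ((A + 1) * K)).2.1 (by simp only; omega)
  have h3 : nc (fun w => loc w = (d, i) ∧ Pt D t d a (pos w) ∧ g' w / K ≠ A) ≤
      nc (fun w => loc w = (d, i) ∧ fr D t (d, i).1 ≤ pos w ∧ g' w < A * K) +
      nc (fun w => loc w = (d, i) ∧ pos w < XX D t (d, i) - fr D t (d, i).1 ∧ (A + 1) * K ≤ g' w) := by
    refine le_trans (nc_mono ?_) (nc_or_le _ _)
    rintro w ⟨hw, ⟨hp1, hp2⟩, hne⟩
    rw [div_ne_iff _ _ _ hK0] at hne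
    have h4 : fr D t d + a % 2 * hh D t d + hh D t d ≤ xs D t d - fr D t d := by
      unfold hh at *
      rcases Nat.mod_two_eq_zero_or_one a with h' | h' <;> rw [h'] <;> omega
    rcases hne with hne | hne
    · left; exact ⟨hw, by simp only; omega, hne⟩
    · right; exact ⟨hw, by rw [hX]; simp only; omega, hne⟩
  have h5 : 256 * nc (fun w => loc w = (d, i) ∧ Pt D t d a (pos w) ∧ g' w / K ≠ A) ≤
      nc (fun w => loc w = (d, i) ∧ g w / K ≠ A) := by omega
  have h6 : (256 : ℝ) * nc (fun w => loc w = (d, i) ∧ Pt D t d a (pos w) ∧ g' w / K ≠ A) ≤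
      nc (fun w => loc w = (d, i) ∧ g w / K ≠ A) := by exact_mod_cast h5
  have h7 := h6.trans hb
  rw [pow_succ (256:ℝ) (j + 1)]
  rw [← div_div]
  linarith

lemma part_near (hD : 1 ≤ D) (ht : t + 8 ≤ 5 * D) (hc : ∀ c, nc (fun w => loc w = c) = XX D t c)
    (hS : Sep D t loc pos g g') (hI : Inv D t loc g)
    (hg : ∀ k a, k ≤ D → a < 2 ^ (D - k) → nc (fun w => g w / 2 ^ k = a) = 2 ^ k)
    (d a : ℕ) (hd : d < D) (ha : a < 2 ^ (d + 1)) (hpar : (t + d) % 2 = 0) :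
    (nc (fun w => loc w = (d, a / 2) ∧ Pt D t d a (pos w) ∧ g' w / 2 ^ (D - d - 1) ≠ a) : ℝ)
      ≤ cap D t d / 128 + cap D t d / 1984 + cap D t d / 112 := by
  have hcp := cap_pos D t d
  rcases Nat.eq_zero_or_pos (hh D t d) with h | h
  · rw [nc_zero]
    · simp; positivity
    · unfold Pt; rw [h]; intro w; omega
  set i := a / 2 with hidef
  have hi : i < 2 ^ d := by rw [pow_succ] at ha; omega
  have hX : XX D t (d, i) = xs D t d := by unfold XX; rw [if_pos hi]
  have h2f : 2 * fr D t d ≤ XX D t (d, i) := by rw [hX]; unfold hh at h; omega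
  set K := 2 ^ (D - d - 1) with hK
  have hK0 : 0 < K := by positivity
  have hb := hI d i 0 hd.le hi
  rw [pow_zero, Nat.div_one, zero_add, pow_one, add_zero] at hb
  have hK2 : 2 ^ (D - d) = 2 * K := by
    rw [hK, ← pow_succ']; congr 1; omega
  rw [hK2] at hb
  have hs := str_split loc (d, i) g (2 * K) i (by omega)
  set st := nc (fun w => loc w = (d, i) ∧ g w / (2 * K) ≠ i)
  -- rounding
  have hxc := xs_cap D hD t (by omega) d
  have hround : (xs D t d : ℝ) / 2 - cap D t d / 512 ≤ ((xs D t d / 2 : ℕ) : ℝ) := by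
    by_cases he : D + 4 * d < t + 8 ∨ d = 0
    · have h1 := xs_even D t hD ht d he
      have h2 : xs D t d = 2 * (xs D t d / 2) := by omega
      have h3 : (xs D t d : ℝ) = 2 * ((xs D t d / 2 : ℕ) : ℝ) := by exact_mod_cast h2
      linarith
    · have h1 : (2:ℝ) ^ 8 ≤ cap D t d := by rw [cap_ge_iff]; omega
      have h2 : xs D t d ≤ 2 * (xs D t d / 2) + 1 := by omega
      have h3 : (xs D t d : ℝ) ≤ 2 * ((xs D t d / 2 : ℕ) : ℝ) + 1 := by exact_mod_cast h2
      linarith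
  have hhalf : ((xs D t d / 2 : ℕ) : ℝ) ≤ cap D t d / 2 := by
    have h2 : 2 * (xs D t d / 2) ≤ xs D t d := by omega
    have h3 : 2 * ((xs D t d / 2 : ℕ) : ℝ) ≤ (xs D t d : ℝ) := by exact_mod_cast h2
    linarith
  -- both cases reduce to this
  have fin : ∀ (far near out N cntv q : ℕ), far + out ≤ st → cntv ≤ N + out → q ≤ far + near →
      256 * near ≤ 256 * (cntv - xs D t d / 2) + xs D t d / 2 →
      (N : ℝ) ≤ xs D t d / 2 + cap D t d / 1984 + cap D t d / 112 →
      (q : ℝ) ≤ cap D t d / 128 + cap D t d / 1984 + cap D t d / 112 := by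
    intro far near out N cntv q h1 h2 h3 h4 h5
    have h1' : (far : ℝ) + out ≤ st := by exact_mod_cast h1
    have h2' : (cntv : ℝ) ≤ N + out := by exact_mod_cast h2
    have h3' : (q : ℝ) ≤ far + near := by exact_mod_cast h3
    have ho : (0:ℝ) ≤ out := by positivity
    have h4' : 256 * (near : ℝ) ≤ 256 * ((cntv - xs D t d / 2 : ℕ) : ℝ) + ((xs D t d / 2 : ℕ) : ℝ) := by
      exact_mod_cast h4
    have h6 : ((cntv - xs D t d / 2 : ℕ) : ℝ) ≤ out + cap D t d / 512 + cap D t d / 1984 + cap D t d / 112 := by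
      rcases le_total cntv (xs D t d / 2) with hle | hle
      · rw [Nat.sub_eq_zero_of_le hle]; push_cast; positivity
      · rw [Nat.cast_sub hle]; linarith
    linarith
  rcases Nat.mod_two_eq_zero_or_one a with hm | hm
  · -- left child
    have hai : a = 2 * i := by omega
    have hbal := balance D t loc g hD (by omega) hc hI hg d (a + 1) hd (by rw [pow_succ] at *; omega) hpar
    have e1 : (a + 1) / 2 = i := by omega
    rw [e1, ← hK] at hbal
    have h4 := (hS.2 (d, i) h2f ((a + 1) * K)).2.2.2
    rw [hX] at h4
    refine fin (nc (fun w => loc w = (d, i) ∧ g w < i * (2 * K))) _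
      (nc (fun w => loc w = (d, i) ∧ (i + 1) * (2 * K) ≤ g w)) _ _ _ hs.ge ?_ ?_ h4 hbal
    · refine le_trans (nc_mono ?_) (nc_or_le _ _)
      rintro w ⟨hw, hge⟩
      by_cases h6 : g w / K = a + 1
      · left; exact ⟨hw, h6⟩
      · right
        rw [← ne_eq, div_ne_iff _ _ _ hK0] at h6
        refine ⟨hw, ?_⟩
        have : (a + 1 + 1) * K = (i + 1) * (2 * K) := by rw [hai]; ring
        omega
    · rw [← hS.1 (d, i) (fun k => k < i * (2 * K))]
      refine le_trans (nc_mono ?_) (nc_or_le _ _)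
      rintro w ⟨hw, ⟨hp1, hp2⟩, hne⟩
      rw [div_ne_iff _ _ _ hK0] at hne
      rw [hm] at hp1 hp2
      rcases hne with hne | hne
      · left
        refine ⟨hw, ?_⟩
        have : a * K = i * (2 * K) := by rw [hai]; ring
        omega
      · right
        refine ⟨hw, ?_, hne⟩
        unfold hh at *
        omega
  · -- right child
    have hai : a = 2 * i + 1 := by omega
    have hbal := balance D t loc g hD (by omega) hc hI hg d (a - 1) hd (by omega) hpar
    have e1 : (a - 1) / 2 = i := by omega
    rw [e1, ← hK] at hbal
    have h4 := (hS.2 (d, i) h2f (a * K)).2.2.1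
    rw [hX] at h4
    refine fin (nc (fun w => loc w = (d, i) ∧ (i + 1) * (2 * K) ≤ g w)) _
      (nc (fun w => loc w = (d, i) ∧ g w < i * (2 * K))) _ _ _ (by omega) ?_ ?_ h4 hbal
    · refine le_trans (nc_mono ?_) (nc_or_le _ _)
      rintro w ⟨hw, hge⟩
      by_cases h6 : g w / K = a - 1
      · left; exact ⟨hw, h6⟩
      · right
        rw [← ne_eq, div_ne_iff _ _ _ hK0] at h6
        refine ⟨hw, ?_⟩
        have e2 : (a - 1) * K = i * (2 * K) := by
          have : a - 1 = 2 * i := by omega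
          rw [this]; ring
        have e3 : a - 1 + 1 = a := by omega
        rw [e3] at h6
        omega
    · rw [← hS.1 (d, i) (fun k => (i + 1) * (2 * K) ≤ k)]
      refine le_trans (nc_mono ?_) (nc_or_le _ _)
      rintro w ⟨hw, ⟨hp1, hp2⟩, hne⟩
      rw [div_ne_iff _ _ _ hK0] at hne
      rw [hm] at hp1 hp2
      rcases hne with hne | hne
      · right
        refine ⟨hw, ?_, hne⟩
        unfold hh at *
        omega
      · left
        refine ⟨hw, ?_⟩
        have : (a + 1) * K = (i + 1) * (2 * K) := by rw [hai]; ring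
        omega

lemma kid (hD : 1 ≤ D) (hc : ∀ c, nc (fun w => loc w = c) = XX D t c)
    (hS : Sep D t loc pos g g') (hI : Inv D t loc g) (d a k j : ℕ) (ha : a < 2 ^ (d + 1)) (hk : k / 2 = a) :
    (nc (fun w => loc w = (d + 2, k) ∧ g' w / 2 ^ (D - (d + 1) + j) ≠ a / 2 ^ j) : ℝ)
      ≤ cap D t d / 256 ^ (j + 1) := by
  have hcp := cap_pos D t d
  by_cases hd : d + 2 ≤ D
  · rw [hS.1 (d + 2, k) (fun v => v / 2 ^ (D - (d + 1) + j) ≠ a / 2 ^ j)]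
    have h := hI (d + 2) k (j + 1) hd (by rw [pow_succ]; omega)
    have e1 : D - (d + 2) + (j + 1) = D - (d + 1) + j := by omega
    have e2 : k / 2 ^ (j + 1) = a / 2 ^ j := by rw [pow_succ', ← Nat.div_div_eq_div_mul, hk]
    rw [e1, e2, cap_add, pow_succ (256:ℝ) (j + 1)] at h
    refine h.trans (le_of_eq ?_)
    field_simp
    norm_num
  · rw [nc_zero]
    · simp; positivity
    · rintro w ⟨hw, _⟩
      exact none_card D t loc hc (d + 2) k (Or.inr (xs_deep D t _ hD (by omega))) w hw

lemma inv_step (hD : 1 ≤ D) (ht : t + 8 ≤ 5 * D) (hc : ∀ c, nc (fun w => loc w = c) = XX D t c)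
    (hpos : ∀ c a b, b ≤ XX D t c → nc (fun w => loc w = c ∧ a ≤ pos w ∧ pos w < b) = b - a)
    (hS : Sep D t loc pos g g') (hI : Inv D t loc g)
    (hlt : ∀ w, g w < 2 ^ D) (hlt' : ∀ w, g' w < 2 ^ D)
    (hg : ∀ k a, k ≤ D → a < 2 ^ (D - k) → nc (fun w => g w / 2 ^ k = a) = 2 ^ k) :
    Inv D (t + 1) (fun w => nl D t (loc w) (pos w)) g' := by
  intro d a j hd ha
  rcases d with _ | d
  · rw [nc_zero]
    · have := cap_pos D (t + 1) 0
      simp; positivity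
    · rintro w ⟨_, h2⟩
      apply h2
      have : a = 0 := by simpa using ha
      subst this
      rw [Nat.zero_div]
      apply Nat.div_eq_of_lt
      exact (hlt' w).trans_le (Nat.pow_le_pow_right (by norm_num) (by omega))
  by_cases hpar : (t + d) % 2 = 1
  · rw [nc_zero]
    · have := cap_pos D (t + 1) (d + 1)
      simp; positivity
    · rintro w ⟨hw, _⟩
      exact none_card D (t + 1) _ (nl_card D t loc pos hD hc hpos) (d + 1) a
        (Or.inr (xs_odd _ _ _ (by omega))) w hw
  have hcp := cap_pos D t d
  have k1 := kid hD hc hS hI d a (2 * a) j ha (by omega)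
  have k2 := kid hD hc hS hI d a (2 * a + 1) j ha (by omega)
  have hsub : nc (fun w => nl D t (loc w) (pos w) = (d + 1, a) ∧ g' w / 2 ^ (D - (d + 1) + j) ≠ a / 2 ^ j)
      ≤ nc (fun w => loc w = (d, a / 2) ∧ Pt D t d a (pos w) ∧ g' w / 2 ^ (D - (d + 1) + j) ≠ a / 2 ^ j) +
       (nc (fun w => loc w = (d + 2, 2 * a) ∧ g' w / 2 ^ (D - (d + 1) + j) ≠ a / 2 ^ j) +
        nc (fun w => loc w = (d + 2, 2 * a + 1) ∧ g' w / 2 ^ (D - (d + 1) + j) ≠ a / 2 ^ j)) := by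
    refine le_trans (nc_mono ?_) ((nc_or_le _ _).trans (Nat.add_le_add_left (nc_or_le _ _) _))
    rintro w ⟨hw, hne⟩
    rw [nl_succ] at hw
    tauto
  have hsub' := (Nat.cast_le (α := ℝ)).mpr hsub
  push_cast at hsub'
  rw [cap_time, cap_succ]
  have hpart : (nc (fun w => loc w = (d, a / 2) ∧ Pt D t d a (pos w) ∧ g' w / 2 ^ (D - (d + 1) + j) ≠ a / 2 ^ j) : ℝ)
      ≤ 6 * (cap D t d / 256 ^ (j + 1)) := by
    rcases j with _ | j
    · have h := part_near hD ht hc hS hI hg d a (by omega) ha (by omega)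
      rw [pow_zero, Nat.div_one, add_zero, zero_add, pow_one, ← Nat.sub_sub]
      refine h.trans ?_
      linarith
    · have h := part_far hS hI hlt d (a / 2) a j (by omega) (by rw [pow_succ] at ha; omega)
      have e1 : D - (d + 1) + (j + 1) = D - d + j := by omega
      have e2 : a / 2 ^ (j + 1) = a / 2 / 2 ^ j := by rw [pow_succ', Nat.div_div_eq_div_mul]
      rw [e1, e2]
      refine h.trans ?_
      have : 0 < cap D t d / 256 ^ (j + 1 + 1) := by positivity
      linarith
  have : 16 * cap D t d / 2 / 256 ^ (j + 1) = 8 * (cap D t d / 256 ^ (j + 1)) := by ring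
  rw [this]
  linarith

end

end AKS

namespace AKS

lemma run_lt {n : ℕ} (L : List (CS (Fin n))) (f : Fin n ≃ Fin n) (w : Fin n) :
    run L (fun w => (f w).1) w < n := by
  obtain ⟨e, he⟩ := run_perm L (fun w => (f w).1)
  rw [he]; exact (f (e w)).2

lemma run_inj {n : ℕ} (L : List (CS (Fin n))) (f : Fin n ≃ Fin n) :
    Function.Injective (run L (fun w => (f w).1)) := by
  obtain ⟨e, he⟩ := run_perm L (fun w => (f w).1)
  rw [he]
  intro a b h
  exact e.injective (f.injective (Fin.ext h))

lemma run_blocks {D : ℕ} (L : List (CS (Fin (2 ^ D)))) (f : Fin (2 ^ D) ≃ Fin (2 ^ D)) (k a : ℕ)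
    (hk : k ≤ D) (ha : a < 2 ^ (D - k)) :
    nc (fun w => run L (fun w => (f w).1) w / 2 ^ k = a) = 2 ^ k := by
  classical
  obtain ⟨e, he⟩ := run_perm L (fun w => (f w).1)
  rw [he, ← nc_eq]
  have : 2 ^ k = (Ico (a * 2 ^ k) ((a + 1) * 2 ^ k)).card := by
    rw [Nat.card_Ico, add_mul, one_mul, Nat.add_sub_cancel_left]
  refine Eq.trans ?_ this.symm
  have hle : (a + 1) * 2 ^ k ≤ 2 ^ D := by
    have : 2 ^ D = 2 ^ (D - k) * 2 ^ k := by rw [← pow_add]; congr 1; omega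
    rw [this]; exact Nat.mul_le_mul_right _ ha
  have hk0 : 0 < 2 ^ k := by positivity
  have key : ∀ v, v / 2 ^ k = a ↔ v ∈ Ico (a * 2 ^ k) ((a + 1) * 2 ^ k) := by
    intro v
    have := div_ne_iff v (2 ^ k) a hk0
    rw [mem_Ico]
    by_cases h : v / 2 ^ k = a
    · simp only [h, ne_eq, not_true, false_iff] at this; simp only [h, true_iff]; omega
    · have h2 := this.mp h
      simp only [h, false_iff]; omega
  refine card_bij (fun w _ => (f (e w)).1) ?_ ?_ ?_
  · intro w hw
    rw [mem_filter] at hw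
    exact (key _).mp hw.2
  · intro w _ w' _ h
    exact e.injective (f.injective (Fin.ext h))
  · intro v hv
    have hv' := mem_Ico.mp hv
    refine ⟨e.symm (f.symm ⟨v, by omega⟩), ?_, by simp⟩
    rw [mem_filter]
    exact ⟨mem_univ _, by simpa using (key v).mpr hv⟩

lemma tree_run : ∃ q, ∀ D, 2 ≤ D → ∀ t, t + 7 ≤ 5 * D → ∃ L : List (CS (Fin (2 ^ D))), L.length = q * t ∧
    ∃ loc : Fin (2 ^ D) → ℕ × ℕ, (∀ c, nc (fun w => loc w = c) = XX D t c) ∧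
    ∀ f : Fin (2 ^ D) ≃ Fin (2 ^ D), Inv D t loc (run L (fun w => (f w).1)) := by
  obtain ⟨q, hq⟩ := separator
  refine ⟨q, fun D hD t => ?_⟩
  induction t with
  | zero =>
    intro _
    refine ⟨[], by simp, fun _ => (0, 0), ?_, ?_⟩
    · rintro ⟨d, i⟩
      by_cases h : d = 0 ∧ i = 0
      · obtain ⟨rfl, rfl⟩ := h
        unfold nc XX
        simp [xs_zero]
      · rw [nc_zero]
        · unfold XX
          simp only [xs_zero]
          by_cases hd : d = 0
          · subst hd
            have : ¬ i < 2 ^ 0 := by simp; omega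
            rw [if_neg this]
          · rw [if_neg hd]; simp
        · intro w hw
          simp only [Prod.mk.injEq] at hw
          exact h ⟨hw.1.symm, hw.2.symm⟩
    · intro f d i j hd hi
      rw [nc_zero]
      · have := cap_pos D 0 d
        simp; positivity
      · rintro w ⟨hw, h2⟩
        simp only [Prod.mk.injEq] at hw
        apply h2
        rw [← hw.2, Nat.zero_div]
        apply Nat.div_eq_of_lt
        refine (run_lt [] f w).trans_le (Nat.pow_le_pow_right (by norm_num) (by omega))
  | succ t ih =>
    intro ht
    obtain ⟨L, hlen, loc, hc, hI⟩ := ih (by omega)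
    obtain ⟨M, hM, pos, hpos, hrun⟩ := bag_step q loc (XX D t) (fun c => fr D t c.1) (by
      intro c h
      refine hq (XX D t c) (fr D t c.1) h ?_
      unfold XX
      split_ifs
      · exact xs_fr D t c.1 (by omega) (by omega)
      · right; omega) (by intro c; rw [nc_eq]; exact hc c)
    simp only [nc_eq] at hpos hrun
    refine ⟨L ++ M, by rw [List.length_append, hlen, hM]; ring, fun w => nl D t (loc w) (pos w),
      nl_card D t loc pos (by omega) hc hpos, ?_⟩
    intro f
    refine inv_step (g := run L (fun w => (f w).1)) (by omega) (by omega) hc hpos ?_ (hI f) (run_lt L f)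
      (run_lt _ f) (run_blocks L f)
    rw [run_append]
    refine ⟨?_, ?_⟩
    · intro c P
      classical
      have := (hrun (run L (fun w => (f w).1)) c).1 P
      exact this
    · intro c h v
      exact (hrun (run L (fun w => (f w).1)) c).2 h v

def revCS (n : ℕ) : CS (Fin n) where
  σ := Fin.rev
  mn := fun p => decide (p.1 < (Fin.rev p).1)
  inv := Fin.rev_rev
  anti := by
    intro p hp
    have h1 : (Fin.rev p).1 ≠ p.1 := fun h => hp (Fin.ext h)
    simp only [Fin.rev_rev]
    by_cases h : p.1 < (Fin.rev p).1
    · have h2 : ¬ (Fin.rev p).1 < p.1 := by omega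
      rw [decide_eq_true h, decide_eq_false h2]; rfl
    · have h2 : (Fin.rev p).1 < p.1 := by omega
      rw [decide_eq_false h, decide_eq_true h2]; rfl

lemma rev_stage {n : ℕ} (hn : n = 2) (g : Fin n → ℕ) (hinj : Function.Injective g) (i : ℕ)
    (hg : ∀ p, g p / 2 = i) (p : Fin n) : run [revCS n] g p = 2 * i + p.1 := by
  subst hn
  have h0 := hg 0
  have h1 := hg 1
  have hne : g 0 ≠ g 1 := fun h => by have := hinj h; simp at this
  have r0 : Fin.rev (0 : Fin 2) = 1 := rfl
  have r1 : Fin.rev (1 : Fin 2) = 0 := rfl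
  rw [run_cons, run_nil]
  unfold CS.app revCS
  fin_cases p
  · simp [r0]; omega
  · simp [r1]; omega

lemma sort_pow2 : ∃ q, ∀ D, 2 ≤ D → ∃ (L : List (CS (Fin (2 ^ D)))) (π : Fin (2 ^ D) → ℕ),
    L.length ≤ q * D ∧ ∀ f : Fin (2 ^ D) ≃ Fin (2 ^ D), ∀ w, run L (fun w => (f w).1) w = π w := by
  classical
  obtain ⟨q, hq⟩ := tree_run
  refine ⟨5 * q + 1, fun D hD => ?_⟩
  obtain ⟨L, hlen, loc, hc, hI⟩ := hq D hD (5 * D - 7) (by omega)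
  set t := 5 * D - 7 with ht
  obtain ⟨e, he⟩ := fibre_equiv loc (XX D t) (by intro c; rw [nc_eq]; exact hc c)
  obtain ⟨M, hM, hrun⟩ := sig_run 1 (fun c => [revCS (XX D t c)]) (fun c => rfl)
  have hr : ∀ (g : Fin (2 ^ D) → ℕ) (c) (p : Fin (XX D t c)),
      run (M.map (embed e.symm.toEmbedding)) g (e.symm ⟨c, p⟩) = run [revCS (XX D t c)] (fun p => g (e.symm ⟨c, p⟩)) p := by
    intro g c p
    have h1 := congrFun (embed_run e.symm.toEmbedding M g) ⟨c, p⟩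
    have h2 := congrFun (hrun (fun z => g (e.symm z)) c) p
    exact h1.trans h2
  refine ⟨L ++ M.map (embed e.symm.toEmbedding), fun w => 2 * (e w).1.2 + (e w).2.1, ?_, ?_⟩
  · rw [List.length_append, hlen, List.length_map, hM]
    have : q * t ≤ q * (5 * D) := Nat.mul_le_mul_left _ (by omega)
    nlinarith
  · intro f w
    rw [run_append]
    set g := run L (fun w => (f w).1) with hgdef
    obtain ⟨z, rfl⟩ := e.symm.surjective w
    obtain ⟨⟨d, i⟩, p⟩ := z
    have hps : 2 * (e (e.symm ⟨(d, i), p⟩)).1.2 + (e (e.symm ⟨(d, i), p⟩)).2.1 = 2 * i + p.1 :=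
      congrArg (fun z : Σ c, Fin (XX D t c) => 2 * z.1.2 + z.2.1) (e.apply_symm_apply ⟨(d, i), p⟩)
    refine Eq.trans ?_ hps.symm
    rw [hr]
    have hpp := p.2
    have hX : XX D t (d, i) = if i < 2 ^ d then xs D t d else 0 := rfl
    have hi : i < 2 ^ d := by
      by_contra h
      rw [if_neg h] at hX
      omega
    rw [if_pos hi, final_sizes D t d hD (by omega)] at hX
    have hd : d = D - 1 := by
      by_contra h
      rw [if_neg h] at hX
      omega
    rw [if_pos hd] at hX
    refine rev_stage hX _ ?_ i ?_ p
    · intro a b h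
      have := e.symm.injective (run_inj L f h)
      simpa using this
    · intro p
      have h1 := hI f d i 0 (by omega) hi
      have h2 : ¬ ((2:ℝ) ^ 4 ≤ cap D t d) := by rw [cap_ge_iff]; omega
      have h3 : (nc (fun w => loc w = (d, i) ∧ g w / 2 ^ (D - d + 0) ≠ i / 2 ^ 0) : ℝ) < 1 := by
        refine h1.trans_lt ?_
        norm_num at h2 ⊢
        linarith
      have h4 : nc (fun w => loc w = (d, i) ∧ g w / 2 ^ (D - d + 0) ≠ i / 2 ^ 0) = 0 := by
        have : nc (fun w => loc w = (d, i) ∧ g w / 2 ^ (D - d + 0) ≠ i / 2 ^ 0) < 1 := by exact_mod_cast h3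
        omega
      have h5 := nc_none h4 (e.symm ⟨(d, i), p⟩)
      have h6 : loc (e.symm ⟨(d, i), p⟩) = (d, i) := by rw [← he]; simp
      have h7 : D - d + 0 = 1 := by omega
      rw [h7, pow_zero, Nat.div_one, pow_one] at h5
      by_contra h8
      exact h5 ⟨h6, h8⟩

end AKS

namespace AKS

lemma weak_sort {N : ℕ} (L : List (CS (Fin N))) (π : Fin N → ℕ)
    (h : ∀ f : Fin N ≃ Fin N, ∀ w, run L (fun w => (f w).1) w = π w)
    {α : Type*} [LinearOrder α] (g : Fin N → α) (u w : Fin N) (huw : π u ≤ π w) :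
    run L g u ≤ run L g w := by
  set s := Tuple.sort g with hs
  have hm : Monotone (g ∘ s) := Tuple.monotone_sort g
  have h1 : g = fun w => (g ∘ s) (s.symm w) := by funext w; simp
  rw [h1, run_comp L (fun w => s.symm w) hm]
  apply hm
  have h2 := h s.symm
  have h3 := run_comp L (fun w => s.symm w) (φ := fun x : Fin N => x.1) (fun a b h => h)
  rw [h3] at h2
  have hu := h2 u
  have hw := h2 w
  simp only at hu hw
  rw [Fin.le_def, hu, hw]
  exact huw

/-- padding by top elements -/
noncomputable def pad {V W : Type*} (ι : V ↪ W) (f : V → ℕ) : W → WithTop ℕ :=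
  Function.extend ι (fun v => (f v : WithTop ℕ)) (fun _ => ⊤)

lemma pad_apply {V W : Type*} (ι : V ↪ W) (f : V → ℕ) (v : V) : pad ι f (ι v) = f v :=
  ι.injective.extend_apply _ _ _

lemma pad_off {V W : Type*} (ι : V ↪ W) (f : V → ℕ) (w : W) (h : ¬ ∃ v, ι v = w) :
    pad ι f w = ⊤ := Function.extend_apply' _ _ _ h

lemma pad_step {V W : Type*} (ι : V ↪ W) (s : CS W) : ∃ (s' : CS V) (ι' : V ↪ W),
    ∀ f : V → ℕ, s.app (pad ι f) = pad ι' (s'.app f) := by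
  classical
  let τ : V → V := fun v => if h : ∃ u, ι u = s.σ (ι v) then h.choose else v
  have τ1 : ∀ v u, ι u = s.σ (ι v) → τ v = u := by
    intro v u hu
    have h : ∃ u, ι u = s.σ (ι v) := ⟨u, hu⟩
    simp only [τ, dif_pos h]
    exact ι.injective (h.choose_spec.trans hu.symm)
  have τ2 : ∀ v, (¬ ∃ u, ι u = s.σ (ι v)) → τ v = v := by
    intro v h
    simp only [τ, dif_neg h]
  let s' : CS V :=
    { σ := τ
      mn := fun v => s.mn (ι v)
      inv := by
        intro v
        by_cases h : ∃ u, ι u = s.σ (ι v)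
        · obtain ⟨u, hu⟩ := h
          rw [τ1 v u hu]
          exact τ1 u v (by rw [hu, s.inv])
        · rw [τ2 v h, τ2 v h]
      anti := by
        intro v hv
        by_cases h : ∃ u, ι u = s.σ (ι v)
        · obtain ⟨u, hu⟩ := h
          rw [τ1 v u hu] at hv ⊢
          rw [hu]
          apply s.anti
          rw [← hu]
          exact fun h => hv (ι.injective h)
        · exact absurd (τ2 v h) hv }
  let j : V → W := fun v => if (∃ u, ι u = s.σ (ι v)) ∨ s.mn (ι v) = true then ι v else s.σ (ι v)
  have σinj : Function.Injective s.σ := Function.LeftInverse.injective s.inv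
  have hj : Function.Injective j := by
    intro v w h
    simp only [j] at h
    split_ifs at h with h1 h2 h2
    · exact ι.injective h
    · exact absurd (Or.inl ⟨v, h⟩) h2
    · exact absurd (Or.inl ⟨w, h.symm⟩) h1
    · exact ι.injective (σinj h)
  refine ⟨s', ⟨j, hj⟩, fun f => ?_⟩
  funext w
  by_cases hw : ∃ v, j v = w
  · obtain ⟨v, rfl⟩ := hw
    refine Eq.trans ?_ (pad_apply ⟨j, hj⟩ (s'.app f) v).symm
    by_cases h : ∃ u, ι u = s.σ (ι v)
    · have hjv : j v = ι v := by simp only [j]; rw [if_pos (Or.inl h)]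
      obtain ⟨u, hu⟩ := h
      have hs : s'.σ v = u := τ1 v u hu
      have hm : s'.mn v = s.mn (ι v) := rfl
      rw [hjv]
      unfold CS.app
      rw [hs, hm, ← hu, pad_apply, pad_apply]
      split_ifs
      · exact (WithTop.coe_min _ _).symm
      · exact (WithTop.coe_max _ _).symm
    · have hs : s'.σ v = v := τ2 v h
      have happ : s'.app f v = f v := by
        unfold CS.app; rw [hs]; simp
      rw [happ]
      by_cases hm : s.mn (ι v) = true
      · have hjv : j v = ι v := by simp only [j]; rw [if_pos (Or.inr hm)]
        rw [hjv]
        unfold CS.app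
        rw [if_pos hm, pad_apply, pad_off ι f _ h, min_top_right]
      · have hjv : j v = s.σ (ι v) := by
          simp only [j]; rw [if_neg]; rintro (h1 | h1)
          · exact h h1
          · exact hm h1
        have hne : s.σ (ι v) ≠ ι v := fun h1 => h ⟨v, h1.symm⟩
        rw [hjv]
        unfold CS.app
        rw [s.anti _ hne, s.inv, pad_apply, pad_off ι f _ h]
        simp only [Bool.not_eq_true] at hm
        simp [hm]
  · refine Eq.trans ?_ (pad_off ⟨j, hj⟩ (s'.app f) w hw).symm
    by_cases hwι : ∃ v, ι v = w
    · obtain ⟨v, rfl⟩ := hwι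
      have h : ¬ ((∃ u, ι u = s.σ (ι v)) ∨ s.mn (ι v) = true) := by
        intro h
        exact hw ⟨v, by simp only [j]; rw [if_pos h]⟩
      rw [not_or] at h
      unfold CS.app
      rw [if_neg h.2, pad_off ι f _ h.1, max_top_right]
    · unfold CS.app
      rw [pad_off ι f w hwι]
      by_cases h : ∃ v, ι v = s.σ w
      · obtain ⟨v, hv⟩ := h
        have hne : s.σ w ≠ w := fun h1 => hwι ⟨v, hv.trans h1⟩
        by_cases hm : s.mn w = true
        · exfalso
          apply hw
          refine ⟨v, ?_⟩
          simp only [j]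
          rw [if_neg, hv, s.inv]
          rintro (⟨u, hu⟩ | h1)
          · rw [hv, s.inv] at hu; exact hwι ⟨u, hu⟩
          · rw [hv, s.anti w hne, hm] at h1; simp at h1
        · rw [if_neg hm, max_top_left]
      · rw [pad_off ι f _ h]; simp

lemma pad_run {V W : Type*} (L : List (CS W)) (ι : V ↪ W) : ∃ (L' : List (CS V)) (ι' : V ↪ W),
    L'.length = L.length ∧ ∀ f : V → ℕ, run L (pad ι f) = pad ι' (run L' f) := by
  induction L generalizing ι with
  | nil => exact ⟨[], ι, rfl, fun f => rfl⟩
  | cons s L ih =>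
    obtain ⟨s', ι', h⟩ := pad_step ι s
    obtain ⟨L', ι'', hl, h'⟩ := ih ι'
    refine ⟨s' :: L', ι'', by simp [hl], fun f => ?_⟩
    rw [run_cons, run_cons, h, h']

lemma sort_any : ∃ q : ℕ, ∀ (V : Type) [Fintype V] (D : ℕ), 2 ≤ D → Fintype.card V ≤ 2 ^ D →
    ∃ (L : List (CS V)) (π : V ≃ Fin (Fintype.card V)), L.length ≤ q * D ∧
    ∀ f : V → ℕ, Function.Injective f → ∀ u w, π u < π w → run L f u < run L f w := by
  obtain ⟨q, hq⟩ := sort_pow2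
  refine ⟨q, fun V _ D hD hV => ?_⟩
  obtain ⟨L, π, hL, hs⟩ := hq D hD
  let e := Fintype.equivFin V
  let ι : V ↪ Fin (2 ^ D) := e.toEmbedding.trans (Fin.castLEEmb hV)
  obtain ⟨L', ι', hl, hrun⟩ := pad_run L ι
  let r : Fin (Fintype.card V) → ℕ := fun i => π (ι' (e.symm i))
  have hm : Monotone (r ∘ Tuple.sort r) := Tuple.monotone_sort r
  refine ⟨L', e.trans (Tuple.sort r).symm, by omega, fun f hf u w huw => ?_⟩
  have h1 : r (e u) ≤ r (e w) := by
    have := hm huw.le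
    simpa using this
  have h2 : π (ι' u) ≤ π (ι' w) := by simpa [r] using h1
  have h3 := weak_sort L π hs (pad ι f) _ _ h2
  rw [hrun, pad_apply, pad_apply] at h3
  have h4 : run L' f u ≤ run L' f w := by exact_mod_cast h3
  refine lt_of_le_of_ne h4 ?_
  obtain ⟨σ, hσ⟩ := run_perm L' f
  rw [hσ]
  intro h5
  have := σ.injective (hf h5)
  subst this
  exact lt_irrefl _ huw

end AKS

namespace AKS

section mk
variable {V : Type} [Fintype V] {G : SimpleGraph V}

open scoped Classical in
/-- a stage of the graph from a compare-exchange stage using only edges of the graph -/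
noncomputable def mkStage (s : CS V) (h : ∀ v, s.σ v ≠ v → G.Adj v (s.σ v)) (d : Bool) : Stage G where
  pairs := univ.filter (fun p => p.2 = s.σ p.1 ∧ p.1 ≠ p.2 ∧ s.mn p.1 = true)
  adj := by
    rintro ⟨a, b⟩ hp
    simp only [mem_filter, mem_univ, true_and] at hp
    obtain ⟨rfl, h2, _⟩ := hp
    exact h a h2.symm
  directed := fun _ => d
  disj := by
    rintro ⟨a, b⟩ hp ⟨a', b'⟩ hq hne
    simp only [mem_filter, mem_univ, true_and] at hp hq
    obtain ⟨rfl, h2, h3⟩ := hp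
    obtain ⟨rfl, h2', h3'⟩ := hq
    have ha : a ≠ a' := by rintro rfl; exact hne rfl
    refine ⟨ha, ?_, ?_, ?_⟩
    · rintro rfl
      have := s.anti a' h2'.symm
      rw [h3, h3'] at this; simp at this
    · rintro rfl
      have := s.anti a h2.symm
      rw [h3, h3'] at this; simp at this
    · intro h4
      apply ha
      rw [← s.inv a, ← s.inv a']
      exact congrArg s.σ h4

lemma mkStage_apply (s : CS V) (h : ∀ v, s.σ v ≠ v → G.Adj v (s.σ v)) (d : Bool) (f : V → ℕ) :
    (mkStage s h d).apply f = if d then s.app f else fun v => f (s.σ v) := by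
  classical
  funext v
  have hmem : ∀ p, p ∈ (mkStage s h d).pairs ↔ (p.2 = s.σ p.1 ∧ p.1 ≠ p.2 ∧ s.mn p.1 = true) := by
    intro p
    simp [mkStage]
  have hd : ∀ p, (mkStage s h d).directed p = d := fun _ => rfl
  unfold Stage.apply
  by_cases h1 : ∃ p, p ∈ (mkStage s h d).pairs ∧ p.1 = v
  · rw [dif_pos h1, hd]
    obtain ⟨hp, hv⟩ := h1.choose_spec
    obtain ⟨e1, e2, e3⟩ := (hmem _).mp hp
    rw [e1, hv]
    rw [hv] at e3
    cases d
    · simp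
    · simp [CS.app, e3]
  · rw [dif_neg h1]
    by_cases h2 : ∃ p, p ∈ (mkStage s h d).pairs ∧ p.2 = v
    · rw [dif_pos h2, hd]
      obtain ⟨hp, hv⟩ := h2.choose_spec
      obtain ⟨e1, e2, e3⟩ := (hmem _).mp hp
      have e4 : h2.choose.1 = s.σ v :=
        (s.inv _).symm.trans (congrArg s.σ (e1.symm.trans hv))
      have e5 : s.σ v ≠ v := fun h => e2 (e4.trans (h.trans hv.symm))
      have e6 := s.anti v e5
      rw [← e4, e3] at e6
      have e7 : s.mn v = false := by
        cases h : s.mn v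
        · rfl
        · rw [h] at e6; simp at e6
      rw [hv, e4]
      cases d
      · simp
      · simp [CS.app, e7, max_comm]
    · rw [dif_neg h2]
      have hfix : s.σ v = v := by
        by_contra hne
        cases hm : s.mn v
        · apply h2
          refine ⟨(s.σ v, v), (hmem _).mpr ⟨(s.inv v).symm, hne, ?_⟩, rfl⟩
          change s.mn (s.σ v) = true
          rw [s.anti v hne, hm]; rfl
        · exact h1 ⟨(v, s.σ v), (hmem _).mpr ⟨rfl, Ne.symm hne, hm⟩, rfl⟩
      cases d
      · simp [hfix]
      · simp [CS.app, hfix]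

/-- swap the two copies -/
def base (R : Type) : CS (R ⊕ R) where
  σ := Sum.swap
  mn := Sum.isLeft
  inv := by rintro (a | a) <;> rfl
  anti := by rintro (a | a) _ <;> rfl

lemma base_adj {R : Type} (ι : R ⊕ R ↪ V) (h : ∀ r, G.Adj (ι (Sum.inl r)) (ι (Sum.inr r))) (v : V)
    (hv : (embed ι (base R)).σ v ≠ v) : G.Adj v ((embed ι (base R)).σ v) := by
  by_cases hx : ∃ z, ι z = v
  · obtain ⟨z, rfl⟩ := hx
    rw [embed_σ]
    rcases z with r | r
    · exact h r
    · exact (h r).symm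
  · exact absurd (embed_σ_off ι _ v (fun u hu => hx ⟨u, hu⟩)) hv

lemma inner_sim (C : V → Prop) (hadj : ∀ a b, C a → ¬ C b → G.Adj a b) (s : CS V)
    (hs : ∀ v, s.σ v ≠ v → C v)
    (hcard : Nat.card {v // C v} ≤ 2 * Nat.card {v // ¬ C v}) :
    ∃ L : List (Stage G), L.length = 3 ∧ ∀ f, runNetwork L f = s.app f := by
  classical
  let R := {a // s.mn a = true ∧ s.σ a ≠ a}
  have hσne : ∀ v, s.σ v ≠ v → s.σ (s.σ v) ≠ s.σ v := by
    intro v hv; rw [s.inv]; exact hv.symm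
  have σinj : Function.Injective s.σ := Function.LeftInverse.injective s.inv
  have hmix : ∀ a b : R, a.1 ≠ s.σ b.1 := by
    intro a b h
    have h1 := s.anti b.1 b.2.2
    rw [← h, a.2.1, b.2.1] at h1
    simp at h1
  have hRR : Nat.card (R ⊕ R) ≤ Nat.card {v // C v} := by
    refine Nat.card_le_card_of_injective
      (Sum.elim (fun r : R => (⟨r.1, hs _ r.2.2⟩ : {v // C v})) (fun r : R => ⟨s.σ r.1, hs _ (hσne _ r.2.2)⟩)) ?_
    rintro (a | a) (b | b) h
    · simp only [Sum.elim_inl, Subtype.mk.injEq] at h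
      rw [Subtype.ext h]
    · simp only [Sum.elim_inl, Sum.elim_inr, Subtype.mk.injEq] at h
      exact absurd h (hmix a b)
    · simp only [Sum.elim_inl, Sum.elim_inr, Subtype.mk.injEq] at h
      exact absurd h.symm (hmix b a)
    · simp only [Sum.elim_inr, Subtype.mk.injEq] at h
      rw [Subtype.ext (σinj h)]
  have hR : Fintype.card R ≤ Fintype.card {v // ¬ C v} := by
    rw [Nat.card_sum] at hRR
    rw [← Nat.card_eq_fintype_card, ← Nat.card_eq_fintype_card]
    omega
  obtain ⟨j⟩ := Function.Embedding.nonempty_of_card_le hR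
  have hjC : ∀ r, ¬ C (j r).1 := fun r => (j r).2
  have hRC : ∀ r : R, C r.1 := fun r => hs _ r.2.2
  have hRC' : ∀ r : R, C (s.σ r.1) := fun r => hs _ (hσne _ r.2.2)
  let ιk : R ⊕ R ↪ V := ⟨Sum.elim (fun r => r.1) (fun r => (j r).1), by
    rintro (a | a) (b | b) h
    · simp only [Sum.elim_inl] at h
      rw [Subtype.ext h]
    · simp only [Sum.elim_inl, Sum.elim_inr] at h
      exact absurd (h ▸ hRC a) (hjC b)
    · simp only [Sum.elim_inl, Sum.elim_inr] at h
      exact absurd (h ▸ hRC b) (hjC a)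
    · simp only [Sum.elim_inr] at h
      rw [j.injective (Subtype.ext h)]⟩
  let ιt : R ⊕ R ↪ V := ⟨Sum.elim (fun r => s.σ r.1) (fun r => (j r).1), by
    rintro (a | a) (b | b) h
    · simp only [Sum.elim_inl] at h
      rw [Subtype.ext (σinj h)]
    · simp only [Sum.elim_inl, Sum.elim_inr] at h
      exact absurd (h ▸ hRC' a) (hjC b)
    · simp only [Sum.elim_inl, Sum.elim_inr] at h
      exact absurd (h ▸ hRC' b) (hjC a)
    · simp only [Sum.elim_inr] at h
      rw [j.injective (Subtype.ext h)]⟩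
  let κ := embed ιk (base R)
  let τ := embed ιt (base R)
  have hκ : ∀ v, κ.σ v ≠ v → G.Adj v (κ.σ v) :=
    base_adj ιk (fun r => hadj _ _ (hRC r) (hjC r))
  have hτ : ∀ v, τ.σ v ≠ v → G.Adj v (τ.σ v) :=
    base_adj ιt (fun r => hadj _ _ (hRC' r) (hjC r))
  refine ⟨[mkStage τ hτ false, mkStage κ hκ true, mkStage τ hτ false], rfl, fun f => ?_⟩
  have hrun : runNetwork [mkStage τ hτ false, mkStage κ hκ true, mkStage τ hτ false] f
      = fun v => κ.app (fun v => f (τ.σ v)) (τ.σ v) := by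
    simp only [runNetwork, List.foldl_cons, List.foldl_nil, mkStage_apply]
    simp
  rw [hrun]
  have t1 : ∀ r : R, τ.σ r.1 = r.1 := by
    intro r
    apply embed_σ_off
    rintro (u | u) h
    · exact hmix r u h.symm
    · exact hjC u (by have h' : (j u).1 = r.1 := h; rw [h']; exact hRC r)
  have t2 : ∀ r : R, τ.σ (s.σ r.1) = (j r).1 := fun r => embed_σ ιt (base R) (Sum.inl r)
  have t3 : ∀ r : R, τ.σ (j r).1 = s.σ r.1 := fun r => embed_σ ιt (base R) (Sum.inr r)
  have k1 : ∀ r : R, κ.σ r.1 = (j r).1 := fun r => embed_σ ιk (base R) (Sum.inl r)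
  have k2 : ∀ r : R, κ.σ (j r).1 = r.1 := fun r => embed_σ ιk (base R) (Sum.inr r)
  have k3 : ∀ r : R, κ.σ (s.σ r.1) = s.σ r.1 := by
    intro r
    apply embed_σ_off
    rintro (u | u) h
    · exact hmix u r h
    · exact hjC u (by have h' : (j u).1 = s.σ r.1 := h; rw [h']; exact hRC' r)
  have m1 : ∀ r : R, κ.mn r.1 = true := fun r => embed_mn ιk (base R) (Sum.inl r)
  have m2 : ∀ r : R, κ.mn (j r).1 = false := fun r => embed_mn ιk (base R) (Sum.inr r)
  funext v
  by_cases hv : s.σ v = v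
  · have hR : s.app f v = f v := by unfold CS.app; rw [hv]; simp
    rw [hR]
    by_cases hx : ∃ r, (j r).1 = v
    · obtain ⟨r, rfl⟩ := hx
      rw [t3]
      unfold CS.app
      rw [k3]; beta_reduce; rw [t2]; simp
    · have ht : τ.σ v = v := by
        apply embed_σ_off
        rintro (u | u) h
        · have h' : s.σ u.1 = v := h
          rw [← h', s.inv] at hv
          exact u.2.2 hv.symm
        · exact hx ⟨u, h⟩
      have hk : κ.σ v = v := by
        apply embed_σ_off
        rintro (u | u) h
        · have h' : u.1 = v := h
          rw [← h'] at hv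
          exact u.2.2 hv
        · exact hx ⟨u, h⟩
      rw [ht]
      unfold CS.app
      rw [hk]; beta_reduce; rw [ht]; simp
  · cases hm : s.mn v
    · have hm' : s.mn (s.σ v) = true := by rw [s.anti v hv, hm]; rfl
      let r : R := ⟨s.σ v, hm', hσne v hv⟩
      have hr : s.σ r.1 = v := s.inv v
      have hr2 : r.1 = s.σ v := rfl
      have h1 := t2 r
      rw [hr] at h1
      rw [h1]
      unfold CS.app
      rw [m2, k2]; beta_reduce; rw [t3, t1, hm, hr, hr2]
    · let r : R := ⟨v, hm, hv⟩
      have hr : r.1 = v := rfl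
      have h1 := t1 r
      have h2 := k1 r
      have h3 := m1 r
      rw [hr] at h1 h2 h3
      rw [h1]
      unfold CS.app
      rw [h3, h2]; beta_reduce; rw [t3, h1, hm, hr]

open scoped Classical in
noncomputable def restr (s : CS V) (P : V → Prop) (hP : ∀ v, P v → P (s.σ v)) : CS V where
  σ := fun v => if P v then s.σ v else v
  mn := s.mn
  inv := by
    intro v
    by_cases h : P v
    · simp [h, hP v h, s.inv]
    · simp [h]
  anti := by
    intro v hv
    by_cases h : P v
    · simp only [h, if_true] at hv ⊢
      exact s.anti v hv
    · simp [h] at hv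

open scoped Classical in
lemma restr_app (s : CS V) (P : V → Prop) (hP : ∀ v, P v → P (s.σ v)) (f : V → ℕ) (v : V) :
    (restr s P hP).app f v = if P v then s.app f v else f v := by
  unfold CS.app restr
  by_cases h : P v <;> simp [h]

lemma restr_ne (s : CS V) (P : V → Prop) (hP : ∀ v, P v → P (s.σ v)) (v : V)
    (h : (restr s P hP).σ v ≠ v) : P v ∧ (restr s P hP).σ v = s.σ v := by
  classical
  by_cases hp : P v
  · exact ⟨hp, by simp [restr, hp]⟩
  · simp [restr, hp] at h

lemma runNetwork_append (L M : List (Stage G)) (f : V → ℕ) :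
    runNetwork (L ++ M) f = runNetwork M (runNetwork L f) := by
  simp [runNetwork, List.foldl_append]

lemma sim_one (A : V → Prop) (hadj : ∀ a b, A a → ¬ A b → G.Adj a b)
    (h1 : Nat.card {v // A v} ≤ 2 * Nat.card {v // ¬ A v})
    (h2 : Nat.card {v // ¬ A v} ≤ 2 * Nat.card {v // A v}) (s : CS V) :
    ∃ L : List (Stage G), L.length = 7 ∧ ∀ f, runNetwork L f = s.app f := by
  classical
  have hP1 : ∀ v, ¬ (A v ↔ A (s.σ v)) → ¬ (A (s.σ v) ↔ A (s.σ (s.σ v))) := by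
    intro v; rw [s.inv]; tauto
  have hP2 : ∀ v, (A v ∧ A (s.σ v)) → (A (s.σ v) ∧ A (s.σ (s.σ v))) := by
    intro v; rw [s.inv]; tauto
  have hP3 : ∀ v, (¬ A v ∧ ¬ A (s.σ v)) → (¬ A (s.σ v) ∧ ¬ A (s.σ (s.σ v))) := by
    intro v; rw [s.inv]; tauto
  let s1 := restr s (fun v => ¬ (A v ↔ A (s.σ v))) hP1
  let s2 := restr s (fun v => A v ∧ A (s.σ v)) hP2
  let s3 := restr s (fun v => ¬ A v ∧ ¬ A (s.σ v)) hP3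
  have hs1 : ∀ v, s1.σ v ≠ v → G.Adj v (s1.σ v) := by
    intro v hv
    obtain ⟨hp, he⟩ := restr_ne s _ hP1 v hv
    change G.Adj v ((restr s _ hP1).σ v)
    rw [he]
    by_cases ha : A v
    · exact hadj _ _ ha (by tauto)
    · exact (hadj _ _ (by tauto) ha).symm
  obtain ⟨L2, hl2, hr2⟩ := inner_sim A hadj s2 (fun v hv => (restr_ne s _ hP2 v hv).1.1) h1
  obtain ⟨L3, hl3, hr3⟩ := inner_sim (fun v => ¬ A v)
    (fun a b ha hb => (hadj b a (not_not.mp hb) ha).symm) s3 (fun v hv => (restr_ne s _ hP3 v hv).1.1)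
    (by simpa only [not_not] using h2)
  refine ⟨[mkStage s1 hs1 true] ++ (L2 ++ L3), by simp [hl2, hl3], fun f => ?_⟩
  rw [runNetwork_append, runNetwork_append, hr2, hr3]
  have : runNetwork [mkStage s1 hs1 true] f = s1.app f := by
    simp [runNetwork, mkStage_apply]
  rw [this]
  funext v
  simp only [s1, s2, s3, restr_app]
  by_cases ha : A v <;> by_cases hb : A (s.σ v) <;>
    simp [ha, hb, CS.app, restr, s.inv]

lemma sim_all (A : V → Prop) (hadj : ∀ a b, A a → ¬ A b → G.Adj a b)
    (h1 : Nat.card {v // A v} ≤ 2 * Nat.card {v // ¬ A v})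
    (h2 : Nat.card {v // ¬ A v} ≤ 2 * Nat.card {v // A v}) (L : List (CS V)) :
    ∃ M : List (Stage G), M.length = 7 * L.length ∧ ∀ f, runNetwork M f = run L f := by
  induction L with
  | nil => exact ⟨[], rfl, fun f => rfl⟩
  | cons s L ih =>
    obtain ⟨M, hM, hr⟩ := ih
    obtain ⟨M', hM', hr'⟩ := sim_one A hadj h1 h2 s
    refine ⟨M' ++ M, by simp [hM, hM']; ring, fun f => ?_⟩
    rw [runNetwork_append, hr, hr', run_cons]

end mk

lemma card_low (p m k : ℕ) (hk : k ≤ p) :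
    Nat.card {v : Fin p × Fin m // v.1.1 < k} = k * m := by
  classical
  have e : {v : Fin p × Fin m // v.1.1 < k} ≃ Fin k × Fin m :=
    { toFun := fun v => (⟨v.1.1.1, v.2⟩, v.1.2)
      invFun := fun v => ⟨(⟨v.1.1, v.1.2.trans_le hk⟩, v.2), v.1.2⟩
      left_inv := fun v => rfl
      right_inv := fun v => rfl }
  rw [Nat.card_congr e]; simp

lemma card_high (p m k : ℕ) (hk : k ≤ p) :
    Nat.card {v : Fin p × Fin m // ¬ v.1.1 < k} = (p - k) * m := by
  classical
  have h1 := card_low p m k hk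
  have h2 := Fintype.card_subtype_compl (fun v : Fin p × Fin m => v.1.1 < k)
  rw [Nat.card_eq_fintype_card] at h1 ⊢
  rw [h2, h1, Fintype.card_prod, Fintype.card_fin, Fintype.card_fin, Nat.sub_mul]

lemma upper : ∃ q : ℕ, ∀ p m D : ℕ, 2 ≤ p → 2 ≤ D → p * m ≤ 2 ^ D →
    ∃ (π : Fin p × Fin m ≃ Fin (Fintype.card (Fin p × Fin m))) (L : List (Stage (multipartite p m))),
    L.length ≤ q * D ∧ IsSortingNetwork (multipartite p m) π L := by
  obtain ⟨q, hq⟩ := sort_any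
  refine ⟨7 * q, fun p m D hp hD hn => ?_⟩
  obtain ⟨L, π, hL, hs⟩ := hq (Fin p × Fin m) D hD (by simpa using hn)
  obtain ⟨M, hM, hr⟩ := sim_all (G := multipartite p m) (fun v => v.1.1 < p / 2) (by
      intro a b ha hb
      simp only [multipartite, SimpleGraph.comap_adj, SimpleGraph.top_adj]
      intro h
      rw [h] at ha
      exact hb ha)
    (by rw [card_low p m (p / 2) (by omega), card_high p m (p / 2) (by omega), ← mul_assoc]
        exact Nat.mul_le_mul_right _ (by omega))
    (by rw [card_low p m (p / 2) (by omega), card_high p m (p / 2) (by omega), ← mul_assoc]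
        exact Nat.mul_le_mul_right _ (by omega)) L
  refine ⟨π, M, by rw [hM, mul_assoc]; exact Nat.mul_le_mul_left _ hL, ?_⟩
  intro f hf u w huw
  rw [hr]
  exact hs f hf u w huw

end AKS

namespace AKS
section low
variable {V : Type} {G : SimpleGraph V}

lemma apply_dep (s : Stage G) (v : V) : ∃ a b, ∀ f g : V → ℕ, f a = g a → f b = g b →
    s.apply f v = s.apply g v := by
  classical
  by_cases h1 : ∃ p, p ∈ s.pairs ∧ p.1 = v
  · refine ⟨h1.choose.1, h1.choose.2, fun f g ha hb => ?_⟩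
    unfold Stage.apply
    rw [dif_pos h1, dif_pos h1, ha, hb]
  · by_cases h2 : ∃ p, p ∈ s.pairs ∧ p.2 = v
    · refine ⟨h2.choose.1, h2.choose.2, fun f g ha hb => ?_⟩
      unfold Stage.apply
      rw [dif_neg h1, dif_neg h1, dif_pos h2, dif_pos h2, ha, hb]
    · refine ⟨v, v, fun f g ha _ => ?_⟩
      unfold Stage.apply
      rw [dif_neg h1, dif_neg h1, dif_neg h2, dif_neg h2, ha]

lemma apply_mem (s : Stage G) (f : V → ℕ) (v : V) : ∃ w, s.apply f v = f w := by
  classical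
  unfold Stage.apply
  split_ifs with h1 h2 h3 h4
  · rcases min_choice (f h1.choose.1) (f h1.choose.2) with h | h <;> exact ⟨_, h⟩
  · exact ⟨_, rfl⟩
  · rcases max_choice (f h3.choose.1) (f h3.choose.2) with h | h <;> exact ⟨_, h⟩
  · exact ⟨_, rfl⟩
  · exact ⟨_, rfl⟩

lemma net_mem (L : List (Stage G)) (f : V → ℕ) (v : V) : ∃ w, runNetwork L f v = f w := by
  induction L generalizing f with
  | nil => exact ⟨v, rfl⟩
  | cons s L ih =>
    obtain ⟨w, hw⟩ := ih (s.apply f)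
    obtain ⟨w', hw'⟩ := apply_mem s f w
    exact ⟨w', hw.trans hw'⟩

lemma net_dep (L : List (Stage G)) (v : V) : ∃ S : Finset V, S.card ≤ 2 ^ L.length ∧
    ∀ f g : V → ℕ, (∀ u ∈ S, f u = g u) → runNetwork L f v = runNetwork L g v := by
  classical
  induction L using List.reverseRecOn generalizing v with
  | nil => exact ⟨{v}, by simp, fun f g h => h v (by simp)⟩
  | append_singleton L s ih =>
    obtain ⟨a, b, hab⟩ := apply_dep s v
    obtain ⟨S, hS, h1⟩ := ih a
    obtain ⟨T, hT, h2⟩ := ih b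
    refine ⟨S ∪ T, ?_, fun f g h => ?_⟩
    · refine (card_union_le _ _).trans ?_
      rw [List.length_append, List.length_singleton, pow_succ]
      omega
    · simp only [runNetwork, List.foldl_append, List.foldl_cons, List.foldl_nil]
      exact hab _ _ (h1 f g fun u hu => h u (mem_union_left _ hu))
        (h2 f g fun u hu => h u (mem_union_right _ hu))

lemma lower [Fintype V] {n : ℕ} (π : V ≃ Fin n) (L : List (Stage G)) (h : IsSortingNetwork G π L)
    (hn : 0 < n) : n ≤ 2 ^ L.length := by
  classical
  set v := π.symm ⟨0, hn⟩ with hv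
  obtain ⟨S, hS, hdep⟩ := net_dep L v
  have hcard : Fintype.card V = n := by rw [Fintype.card_congr π, Fintype.card_fin]
  by_contra hlt
  have hex : ∃ u, u ∉ S := by
    by_contra hall
    push Not at hall
    have : S = univ := eq_univ_iff_forall.mpr hall
    rw [this, card_univ] at hS
    omega
  obtain ⟨u, hu⟩ := hex
  let f : V → ℕ := fun x => (π x).1 + 1
  let g : V → ℕ := fun x => if x = u then 0 else (π x).1 + 1
  have hfg : runNetwork L f v = runNetwork L g v := by
    apply hdep
    intro x hx
    have : x ≠ u := by rintro rfl; exact hu hx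
    simp [f, g, this]
  have hg : Function.Injective g := by
    intro x y hxy
    simp only [g] at hxy
    split_ifs at hxy with h1 h2 h2
    · rw [h1, h2]
    · exact π.injective (Fin.ext (by omega))
  have hs := h g hg
  choose φ hφ using net_mem L g
  have hinj : Function.Injective φ := by
    intro x y hxy
    have he : runNetwork L g x = runNetwork L g y := by rw [hφ x, hφ y, hxy]
    rcases lt_trichotomy (π x) (π y) with h1 | h1 | h1
    · exact absurd he (hs x y h1).ne
    · exact π.injective h1
    · exact absurd he (hs y x h1).ne'
  obtain ⟨w, hw⟩ := Finite.surjective_of_injective hinj u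
  have hw0 : runNetwork L g w = 0 := by rw [hφ w, hw]; simp [g]
  have hv0 : runNetwork L g v = 0 := by
    by_cases hwv : w = v
    · rw [← hwv]; exact hw0
    · have hlt2 : π v < π w := by
        have h1 : π v = ⟨0, hn⟩ := by rw [hv]; simp
        have h2 : π w ≠ π v := fun h3 => hwv (π.injective h3)
        rw [h1] at h2 ⊢
        rw [Fin.lt_def]
        have : (π w).1 ≠ 0 := fun h3 => h2 (Fin.ext h3)
        simp only
        omega
      have := hs v w hlt2
      omega
  obtain ⟨x, hx⟩ := net_mem L f v
  rw [hfg, hv0] at hx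
  simp [f] at hx

end low
end AKS

/-- the sorting number of the complete `p`-partite graph
`K_{n/p,…,n/p}` on `n = p·m` vertices is `Θ(log n)`. -/
theorem stmt15 :
    ∃ c C : ℝ, 0 < c ∧ 0 < C ∧ ∀ p m : ℕ, 2 ≤ p → 1 ≤ m →
      c * Real.log ((p : ℝ) * m) ≤ (st (multipartite p m) : ℝ) ∧
      (st (multipartite p m) : ℝ) ≤ C * Real.log ((p : ℝ) * m) := by
  obtain ⟨q, hq⟩ := AKS.upper
  refine ⟨1, 6 * q + 1, one_pos, by positivity, fun p m hp hm => ?_⟩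
  have hn2 : 2 ≤ p * m := le_trans hp (Nat.le_mul_of_pos_right p hm)
  have hcast : (p : ℝ) * m = ((p * m : ℕ) : ℝ) := by push_cast; ring
  rw [hcast]
  set n := p * m with hn
  have hcl : n ≤ 2 ^ Nat.clog 2 n := Nat.le_pow_clog (by norm_num) n
  have hcl1 : 1 ≤ Nat.clog 2 n := Nat.clog_pos (by norm_num) hn2
  obtain ⟨π, L, hL, hs⟩ := hq p m (Nat.clog 2 n + 1) hp (by omega)
    (hcl.trans (Nat.pow_le_pow_right (by norm_num) (by omega)))
  have hcardV : Fintype.card (Fin p × Fin m) = n := by simp [hn]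
  have hlog2 : (1 / 2 : ℝ) < Real.log 2 := by have := Real.log_two_gt_d9; linarith
  have hlog2' : Real.log 2 < 1 := by have := Real.log_two_lt_d9; linarith
  have hn2' : (2 : ℝ) ≤ (n : ℝ) := by exact_mod_cast hn2
  have hlogn : Real.log 2 ≤ Real.log n := Real.log_le_log (by norm_num) hn2'
  constructor
  · have hmem := Nat.sInf_mem (s := {t | ∃ π : Fin p × Fin m ≃ Fin (Fintype.card (Fin p × Fin m)),
      ∃ L : List (Stage (multipartite p m)), L.length = t ∧ IsSortingNetwork (multipartite p m) π L})
      ⟨_, π, L, rfl, hs⟩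
    obtain ⟨π', L', hl', hs'⟩ := hmem
    have hst : L'.length = st (multipartite p m) := hl'
    have hlow := AKS.lower π' L' hs' (by omega)
    rw [hcardV, hst] at hlow
    have h1 : (n : ℝ) ≤ 2 ^ st (multipartite p m) := by exact_mod_cast hlow
    have h2 : Real.log n ≤ st (multipartite p m) * Real.log 2 := by
      rw [← Real.log_pow]
      exact Real.log_le_log (by linarith) h1
    have h3 : (0 : ℝ) ≤ st (multipartite p m) := Nat.cast_nonneg _
    nlinarith
  · have hle : st (multipartite p m) ≤ L.length := Nat.sInf_le ⟨π, L, rfl, hs⟩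
    have hle2 : (st (multipartite p m) : ℝ) ≤ q * ((Nat.clog 2 n : ℕ) + 1) := by
      exact_mod_cast hle.trans hL
    have h4 : 2 ^ (Nat.clog 2 n - 1) < n := Nat.pow_pred_clog_lt_self (by norm_num) (by omega)
    have h5 : ((2 : ℝ) ^ (Nat.clog 2 n - 1)) ≤ n := by exact_mod_cast h4.le
    have h6 : ((Nat.clog 2 n - 1 : ℕ) : ℝ) * Real.log 2 ≤ Real.log n := by
      rw [← Real.log_pow]
      exact Real.log_le_log (by positivity) h5
    rw [Nat.cast_sub hcl1, Nat.cast_one] at h6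
    have h7 : (1 : ℝ) ≤ (Nat.clog 2 n : ℕ) := by exact_mod_cast hcl1
    have h8 : ((Nat.clog 2 n : ℕ) : ℝ) + 1 ≤ 6 * Real.log n := by nlinarith
    have hq0 : (0 : ℝ) ≤ q := Nat.cast_nonneg _
    nlinarith
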